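/- Under the standing assumptions (fixed 0<ε<1/4, n^{1/2−o(1)} < k < sqrt((1/4−ε)·n·log n), Λ(Δ) < o(1) a.s., and φ ≤ φ*), almost surely there do not exist in H = H_k(n,p) a nontrivial clique C and a vertex x such that |C| ≥ d_H(x), d_C(x) ≥ τ, and either |C| ≥ α or |C ∖ C_x| ≥ 2/ε. -/

import Mathlib

open Filter

noncomputable section

/-- The collection of all `k`-element subsets of `Fin n`. -/
def kSets (n k : ℕ) : Finset (Finset (Fin n)) := Finset.powersetCard k Finset.univ

open Classical in
/-- The probability that the random hypergraph `H_k(n,p)` (each `k`-subset of `[n]`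
present independently with probability `p`) satisfies the property `P`. -/
def hprob (n k : ℕ) (p : ℝ) (P : Finset (Finset (Fin n)) → Prop) : ℝ :=
  ∑ H ∈ (kSets n k).powerset,
    if P H then p ^ H.card * (1 - p) ^ ((kSets n k).card - H.card) else 0

/-- A family of sets is intersecting (a clique) if no two of its members are disjoint. -/
def IsClique {n : ℕ} (C : Finset (Finset (Fin n))) : Prop :=
  ∀ A ∈ C, ∀ B ∈ C, (A ∩ B).Nonempty

/-- The star of `x` in `H`: the set of edges of `H` containing `x`. -/
def starOf {n : ℕ} (H : Finset (Finset (Fin n))) (x : Fin n) : Finset (Finset (Fin n)) :=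
  H.filter (fun A => x ∈ A)

/-- The degree of `x` in `H`. -/
def vdeg {n : ℕ} (H : Finset (Finset (Fin n))) (x : Fin n) : ℕ := (starOf H x).card

/-- The maximum degree of `H`. -/
def maxDegree {n : ℕ} (H : Finset (Finset (Fin n))) : ℕ :=
  Finset.univ.sup (vdeg H)

/-- A family is nontrivial if it is not contained in a star. -/
def IsNontrivial {n : ℕ} (C : Finset (Finset (Fin n))) : Prop :=
  ¬ ∃ x : Fin n, ∀ A ∈ C, x ∈ A

/-- `H` satisfies (strong) EKR if every maximum-size intersecting subfamily of `H`
is a star of `H`. -/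
def EKR {n : ℕ} (H : Finset (Finset (Fin n))) : Prop :=
  ∀ C ⊆ H, IsClique C → (∀ D ⊆ H, IsClique D → D.card ≤ C.card) →
    ∃ x : Fin n, C = starOf H x

open Classical in
/-- `q = q(n,k)`: the probability that two independent uniform `k`-subsets of `[n]` meet. -/
def interProb (n k : ℕ) : ℝ :=
  ((((kSets n k) ×ˢ (kSets n k)).filter fun AB => (AB.1 ∩ AB.2).Nonempty).card : ℝ) /
    ((kSets n k).card : ℝ) ^ 2

/-- `φ = p·C(n-1,k-1)`, the expected degree of a vertex. -/
def phi (n k : ℕ) (p : ℝ) : ℝ := p * ((n - 1).choose (k - 1) : ℝ)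

/-- `μ̄ = φ·n/k`, the expected number of edges. -/
def mubar (n k : ℕ) (p : ℝ) : ℝ := phi n k p * n / k

/-- The generalized binomial coefficient `C(x,t) = x(x-1)⋯(x-t+1)/t!`. -/
def gchoose (x : ℝ) (t : ℕ) : ℝ := (∏ i ∈ Finset.range t, (x - i)) / (t.factorial : ℝ)

/-- `Λ(t) = C(μ̄,t)·q^{C(t,2)}`. -/
def Lam (n k : ℕ) (p : ℝ) (t : ℕ) : ℝ :=
  gchoose (mubar n k p) t * interProb n k ^ t.choose 2

/-- `Λ'(t)`: equals `0` for `t ≤ 2` and `Λ(t)` otherwise. -/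
def Lam' (n k : ℕ) (p : ℝ) (t : ℕ) : ℝ := if t ≤ 2 then 0 else Lam n k p t

open Classical in
/-- The probability of `E` for a uniform sample from the finite set `s`. -/
def uprob {α : Type*} (s : Finset α) (E : α → Prop) : ℝ :=
  ((s.filter E).card : ℝ) / (s.card : ℝ)

open Classical in
/-- The probability of `E` under the probability mass function `w` on `Ω`. -/
def wprob {Ω : Type*} [Fintype Ω] (w : Ω → ℝ) (E : Ω → Prop) : ℝ :=
  ∑ ω ∈ Finset.univ.filter E, w ω

open Classical in
/-- The probability that the family `{A_1,…,A_m}` formed by `m` independent uniform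
`k`-subsets of `[n]` satisfies `P`. -/
def iidprob (n k m : ℕ) (P : Finset (Finset (Fin n)) → Prop) : ℝ :=
  uprob ((Finset.univ : Finset (Fin m → Finset (Fin n))).filter fun f => ∀ i, f i ∈ kSets n k)
    (fun f => P (Finset.image f Finset.univ))

open Classical in
/-- The probability that the tuple `(A_1,…,A_m)` of independent uniform `k`-subsets of `[n]`
satisfies `P`. -/
def tupleProb (n k m : ℕ) (P : (Fin m → Finset (Fin n)) → Prop) : ℝ :=
  uprob ((Finset.univ : Finset (Fin m → Finset (Fin n))).filter fun f => ∀ i, f i ∈ kSets n k) P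

/-- `Pr(Bin(M,p) ≥ θ)`. -/
def binomProbGe (M : ℕ) (p : ℝ) (θ : ℕ) : ℝ :=
  ∑ j ∈ Finset.Icc θ M, (M.choose j : ℝ) * p ^ j * (1 - p) ^ (M - j)

/-- `φ* = log³ n / log(1/q)`. -/
def phiStar (n k : ℕ) : ℝ := (Real.log n) ^ 3 / Real.log (1 / interProb n k)

/-- `α₁`: the largest integer `t` with `Pr(Bin(C(n-1,k-1),p) ≥ t) ≥ ψ/n`, where `ψ = log n`. -/
def alpha1 (n k : ℕ) (p : ℝ) : ℕ :=
  sSup {t : ℕ | Real.log n / n ≤ binomProbGe ((n - 1).choose (k - 1)) p t}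

/-- `α₂ = min{t : Λ(t) ≤ σ}`. -/
def alpha2 (n k : ℕ) (p σn : ℝ) : ℕ := sInf {t : ℕ | Lam n k p t ≤ σn}

/-- `α = max{α₁, α₂}`. -/
def alphaP (n k : ℕ) (p σn : ℝ) : ℕ := max (alpha1 n k p) (alpha2 n k p σn)

/-- `γ = min{α, φ*/3}`. -/
def gammaP (n k : ℕ) (p σn : ℝ) : ℕ := min (alphaP n k p σn) ⌊phiStar n k / 3⌋₊

/-- `τ = (1-ε)·γ`. -/
def tauP (ε : ℝ) (n k : ℕ) (p σn : ℝ) : ℝ := (1 - ε) * (gammaP n k p σn : ℝ)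

/-- `λ = max{√(log n)/log(1/q), 2·√(log n/log(1/q))}`. -/
def lamP (n k : ℕ) : ℝ :=
  max (Real.sqrt (Real.log n) / Real.log (1 / interProb n k))
    (2 * Real.sqrt (Real.log n / Real.log (1 / interProb n k)))

/-- `w̄ = max{φ²k²/n, 6 log n}`. -/
def wbar (n k : ℕ) (p : ℝ) : ℝ := max (phi n k p ^ 2 * (k : ℝ) ^ 2 / n) (6 * Real.log n)

/-- `q̄ = (1 + 2k²w̄/(q n²))·q`. -/
def qbar (n k : ℕ) (p : ℝ) : ℝ :=
  (1 + 2 * (k : ℝ) ^ 2 * wbar n k p / (interProb n k * (n : ℝ) ^ 2)) * interProb n k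

open Classical in
/-- The probability that the random subset of `H`, keeping each element independently
with probability `ρ`, satisfies `P`. -/
def sprob {β : Type*} [DecidableEq β] (H : Finset β) (ρ : ℝ) (P : Finset β → Prop) : ℝ :=
  ∑ G ∈ H.powerset, if P G then ρ ^ G.card * (1 - ρ) ^ (H.card - G.card) else 0

/-- The degree of `v` in the multiset `{f 0, …, f (m-1)}` (with multiplicity). -/
def tdeg {n m : ℕ} (f : Fin m → Finset (Fin n)) (v : Fin n) : ℕ :=
  (Finset.univ.filter fun i => v ∈ f i).card

/-- An increasing (up-)event in `{0,1}^ι`. -/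
def IncrEvent {ι : Type*} (A : Set (ι → Bool)) : Prop :=
  ∀ x y : ι → Bool, y ≤ x → y ∈ A → x ∈ A

/-- The coordinate `i` affects the event `A`. -/
def Affects {ι : Type*} (i : ι) (A : Set (ι → Bool)) : Prop :=
  ∃ η ∈ A, ∃ ν, ν ∉ A ∧ ∀ j, j ≠ i → η j = ν j

/-- Negative association of a family of `{0,1}`-valued random variables, defined on the
finite probability space `Ω` with probability mass function `w`. -/
def NegAssoc {Ω ι : Type*} [Fintype Ω] (w : Ω → ℝ) (X : ι → Ω → Bool) : Prop :=
  ∀ A B : Set (ι → Bool), IncrEvent A → IncrEvent B →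
    (∀ i, ¬ (Affects i A ∧ Affects i B)) →
    wprob w (fun ω => (fun i => X i ω) ∈ A ∧ (fun i => X i ω) ∈ B) ≤
      wprob w (fun ω => (fun i => X i ω) ∈ A) * wprob w (fun ω => (fun i => X i ω) ∈ B)

/-- `X = X_1 + ⋯ + X_m` for `{0,1}`-valued random variables. -/
def bcount {Ω : Type*} {m : ℕ} (X : Fin m → Ω → Bool) (ω : Ω) : ℕ :=
  (Finset.univ.filter fun i => X i ω = true).card

end

section PartOne

set_option linter.unusedSectionVars false

variable {β : Type*} [DecidableEq β]

/-- Expectation of `f` over the random subset of `K` with density `p`. -/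
noncomputable def EE (p : ℝ) (K : Finset β) (f : Finset β → ℝ) : ℝ :=
  ∑ H ∈ K.powerset, p ^ H.card * (1 - p) ^ (K.card - H.card) * f H

open Classical in
/-- Indicator of a proposition. -/
noncomputable def ind (P : Prop) : ℝ := if P then 1 else 0

lemma ind_pos {P : Prop} (h : P) : ind P = 1 := if_pos h
lemma ind_neg {P : Prop} (h : ¬ P) : ind P = 0 := if_neg h
lemma ind_nonneg (P : Prop) : 0 ≤ ind P := by
  unfold ind; split_ifs <;> norm_num
lemma ind_congr {P Q : Prop} (h : P ↔ Q) : ind P = ind Q := by rw [propext h]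

/-- Probability of `P` for the random subset of `K` with density `p`. -/
noncomputable def PP (p : ℝ) (K : Finset β) (P : Finset β → Prop) : ℝ :=
  EE p K (fun H => ind (P H))

lemma EE_congr {p : ℝ} {K : Finset β} {f g : Finset β → ℝ}
    (h : ∀ H ⊆ K, f H = g H) : EE p K f = EE p K g := by
  unfold EE
  apply Finset.sum_congr rfl
  intro H hH
  rw [h H (Finset.mem_powerset.1 hH)]

lemma EE_empty (p : ℝ) (f : Finset β → ℝ) : EE p ∅ f = f ∅ := by
  simp [EE]

lemma EE_insert (p : ℝ) {a : β} {K : Finset β} (ha : a ∉ K) (f : Finset β → ℝ) :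
    EE p (insert a K) f
      = p * EE p K (fun H => f (insert a H)) + (1 - p) * EE p K f := by
  unfold EE
  rw [Finset.sum_powerset_insert ha, add_comm, Finset.mul_sum, Finset.mul_sum]
  congr 1
  · apply Finset.sum_congr rfl
    intro H hH
    have hH' := Finset.mem_powerset.1 hH
    have : a ∉ H := fun h => ha (hH' h)
    rw [Finset.card_insert_of_notMem this, Finset.card_insert_of_notMem ha,
      Nat.add_sub_add_right]
    ring
  · apply Finset.sum_congr rfl
    intro H hH
    have hc := Finset.card_le_card (Finset.mem_powerset.1 hH)
    rw [Finset.card_insert_of_notMem ha, Nat.succ_sub hc, Nat.succ_eq_add_one, pow_succ]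
    ring

lemma EE_union (p : ℝ) (F F' : Finset β) (hd : Disjoint F F') (f : Finset β → ℝ) :
    EE p (F ∪ F') f = EE p F (fun G => EE p F' (fun G' => f (G ∪ G'))) := by
  induction F using Finset.induction_on generalizing f with
  | empty => simp [EE_empty]
  | insert a s ha ih =>
    have hd' : Disjoint s F' := hd.mono_left (Finset.subset_insert _ _)
    have ha' : a ∉ F' := Finset.disjoint_left.1 hd (Finset.mem_insert_self _ _)
    have : a ∉ s ∪ F' := by simp [ha, ha']
    rw [Finset.insert_union, EE_insert p this, EE_insert p ha, ih hd', ih hd']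
    simp only [Finset.insert_union]

lemma EE_const (p : ℝ) (K : Finset β) (c : ℝ) : EE p K (fun _ => c) = c := by
  induction K using Finset.induction_on with
  | empty => simp [EE_empty]
  | insert a s ha ih => rw [EE_insert p ha, ih]; ring

lemma EE_mono {p : ℝ} (h0 : 0 ≤ p) (h1 : p ≤ 1) {K : Finset β} {f g : Finset β → ℝ}
    (h : ∀ H ⊆ K, f H ≤ g H) : EE p K f ≤ EE p K g := by
  unfold EE
  apply Finset.sum_le_sum
  intro H hH
  have : 0 ≤ 1 - p := by linarith
  exact mul_le_mul_of_nonneg_left (h H (Finset.mem_powerset.1 hH)) (by positivity)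

lemma EE_sum (p : ℝ) (K : Finset β) {ι : Type*} (I : Finset ι) (f : ι → Finset β → ℝ) :
    EE p K (fun H => ∑ i ∈ I, f i H) = ∑ i ∈ I, EE p K (f i) := by
  unfold EE
  rw [Finset.sum_comm]
  simp only [Finset.mul_sum]

lemma EE_mul_const (p : ℝ) (K : Finset β) (f : Finset β → ℝ) (c : ℝ) :
    EE p K (fun H => f H * c) = EE p K f * c := by
  unfold EE
  rw [Finset.sum_mul]
  simp only [mul_assoc]

lemma PP_nonneg {p : ℝ} (h0 : 0 ≤ p) (h1 : p ≤ 1) (K : Finset β) (P : Finset β → Prop) :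
    0 ≤ PP p K P := by
  classical
  unfold PP
  rw [← EE_const p K 0]
  apply EE_mono h0 h1
  intro H _
  exact ind_nonneg _

lemma PP_mono {p : ℝ} (h0 : 0 ≤ p) (h1 : p ≤ 1) {K : Finset β} {P Q : Finset β → Prop}
    (h : ∀ H ⊆ K, P H → Q H) : PP p K P ≤ PP p K Q := by
  classical
  apply EE_mono h0 h1
  intro H hH
  have := h H hH
  by_cases hP : P H
  · rw [ind_pos hP, ind_pos (this hP)]
  · rw [ind_neg hP]; exact ind_nonneg _

lemma PP_compl {p : ℝ} (K : Finset β) (P : Finset β → Prop) :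
    PP p K (fun H => ¬ P H) = 1 - PP p K P := by
  classical
  have : PP p K (fun H => ¬ P H) + PP p K P = 1 := by
    rw [← EE_const p K 1]
    unfold PP EE
    rw [← Finset.sum_add_distrib]
    apply Finset.sum_congr rfl
    intro H _
    by_cases h : P H
    · have e1 := ind_pos h
      have e2 := ind_neg (not_not.2 h)
      simp only [e1, e2]; ring
    · have e1 := ind_neg h
      have e2 := ind_pos h
      simp only [e1, e2]; ring
  linarith

lemma PP_le_sum {p : ℝ} (h0 : 0 ≤ p) (h1 : p ≤ 1) {K : Finset β} {ι : Type*} (I : Finset ι)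
    {P : Finset β → Prop} {Q : ι → Finset β → Prop}
    (h : ∀ H ⊆ K, P H → ∃ i ∈ I, Q i H) : PP p K P ≤ ∑ i ∈ I, PP p K (Q i) := by
  classical
  unfold PP
  rw [← EE_sum]
  apply EE_mono h0 h1
  intro H hH
  by_cases hP : P H
  · obtain ⟨i, hi, hQ⟩ := h H hH hP
    have := Finset.single_le_sum (f := fun i => ind (Q i H))
      (fun j _ => ind_nonneg _) hi
    simp only [ind_pos hQ] at this
    rw [ind_pos hP]
    exact this
  · rw [ind_neg hP]
    exact Finset.sum_nonneg (fun j _ => ind_nonneg _)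

lemma PP_or_le {p : ℝ} (h0 : 0 ≤ p) (h1 : p ≤ 1) {K : Finset β}
    {P Q R : Finset β → Prop}
    (h : ∀ H ⊆ K, P H → Q H ∨ R H) : PP p K P ≤ PP p K Q + PP p K R := by
  have := PP_le_sum h0 h1 (K := K) (P := P) (Finset.univ : Finset Bool)
    (Q := fun b => if b then Q else R) (by
      intro H hH hP
      rcases h H hH hP with h | h
      · exact ⟨true, by simp, by simpa using h⟩
      · exact ⟨false, by simp, by simpa using h⟩)
  simpa using this

lemma PP_exists {p : ℝ} (h0 : 0 ≤ p) (h1 : p ≤ 1) {K : Finset β}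
    {P Q : Finset β → Prop} (h : PP p K P + PP p K Q < 1) :
    ∃ H ⊆ K, ¬ P H ∧ ¬ Q H := by
  by_contra hc
  push Not at hc
  have h2 := PP_or_le h0 h1 (K := K) (P := fun _ => True) (Q := P) (R := Q) (by
    intro H hH _
    by_cases hP : P H
    · exact Or.inl hP
    · exact Or.inr (hc H hH hP))
  have h3 : PP p K (fun _ => True) = 1 := by
    unfold PP; simp [ind_pos trivial, EE_const]
  linarith

lemma PP_superset (p : ℝ) {K T : Finset β} (hT : T ⊆ K) :
    PP p K (fun H => T ⊆ H) = p ^ T.card := by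
  classical
  unfold PP
  induction K using Finset.induction_on generalizing T with
  | empty =>
    have : T = ∅ := Finset.subset_empty.1 hT
    subst this
    simp [EE_empty, ind]
  | insert a s ha ih =>
    rw [EE_insert p ha]
    by_cases haT : a ∈ T
    · have hT' : T.erase a ⊆ s := by
        intro b hb
        have := hT (Finset.mem_of_mem_erase hb)
        rcases Finset.mem_insert.1 this with h | h
        · exact absurd h (Finset.ne_of_mem_erase hb)
        · exact h
      have e1 : EE p s (fun H => ind (T ⊆ insert a H))
          = EE p s (fun H => ind (T.erase a ⊆ H)) := by
        apply EE_congr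
        intro H hH
        exact ind_congr Finset.subset_insert_iff
      have e2 : EE p s (fun H => ind (T ⊆ H)) = EE p s (fun _ => 0) := by
        apply EE_congr
        intro H hH
        apply ind_neg
        intro h
        exact ha (hH (h haT))
      rw [e1, e2, ih hT', EE_const, mul_zero, add_zero, ← pow_succ',
        Finset.card_erase_add_one haT]
    · have hT' : T ⊆ s := (Finset.subset_insert_iff_of_notMem haT).1 hT
      have e1 : EE p s (fun H => ind (T ⊆ insert a H))
          = EE p s (fun H => ind (T ⊆ H)) := by
        apply EE_congr
        intro H hH
        exact ind_congr (Finset.subset_insert_iff_of_notMem haT)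
      rw [e1, ih hT']
      ring

lemma PP_restrict (p : ℝ) {K F : Finset β} (hF : F ⊆ K) (Q : Finset β → Prop) :
    PP p K (fun H => Q (H ∩ F)) = PP p F Q := by
  classical
  unfold PP
  have hK : K = F ∪ (K \ F) := by rw [Finset.union_sdiff_of_subset hF]
  conv_lhs => rw [hK]
  rw [EE_union p F (K \ F) Finset.disjoint_sdiff]
  apply EE_congr
  intro G hG
  have : ∀ G' ⊆ K \ F, ind (Q ((G ∪ G') ∩ F)) = ind (Q G) := by
    intro G' hG'
    have : (G ∪ G') ∩ F = G := by
      ext b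
      simp only [Finset.mem_inter, Finset.mem_union]
      constructor
      · rintro ⟨h | h, h2⟩
        · exact h
        · exact absurd h2 (Finset.mem_sdiff.1 (hG' h)).2
      · intro h; exact ⟨Or.inl h, hG h⟩
    rw [this]
  rw [EE_congr this, EE_const]

lemma PP_card_ge (p : ℝ) (F : Finset β) (t : ℕ) :
    PP p F (fun H => t ≤ H.card) = binomProbGe F.card p t := by
  classical
  unfold PP EE binomProbGe
  rw [Finset.sum_powerset_apply_card
    (fun c => p ^ c * (1 - p) ^ (F.card - c) * ind (t ≤ c))]
  have : Finset.Icc t F.card = (Finset.range (F.card + 1)).filter (fun c => t ≤ c) := by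
    ext c; simp; omega
  rw [this, Finset.sum_filter]
  apply Finset.sum_congr rfl
  intro c _
  split_ifs with h
  · simp [ind_pos h, mul_assoc]
  · simp [ind_neg h]

/-- First moment bound over a family of subsets. -/
lemma PP_exists_superset_le {p : ℝ} (h0 : 0 ≤ p) (h1 : p ≤ 1) {K : Finset β} (m : ℕ)
    {N : Finset β} (hN : N ⊆ K) :
    PP p K (fun H => ∃ T ⊆ H, T ⊆ N ∧ T.card = m) ≤ (p * N.card) ^ m / (m.factorial : ℝ) := by
  have h := PP_le_sum h0 h1 (K := K) (N.powersetCard m)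
    (P := fun H => ∃ T ⊆ H, T ⊆ N ∧ T.card = m) (Q := fun T H => T ⊆ H) (by
      rintro H hH ⟨T, h1, h2, h3⟩
      exact ⟨T, Finset.mem_powersetCard.2 ⟨h2, h3⟩, h1⟩)
  refine h.trans ?_
  have : ∀ T ∈ N.powersetCard m, PP p K (fun H => T ⊆ H) = p ^ m := by
    intro T hT
    obtain ⟨h2, h3⟩ := Finset.mem_powersetCard.1 hT
    rw [PP_superset p (h2.trans hN), h3]
  rw [Finset.sum_congr rfl this, Finset.sum_const, Finset.card_powersetCard, nsmul_eq_mul]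
  have := Nat.choose_le_pow_div (α := ℝ) m N.card
  calc ((N.card.choose m : ℕ) : ℝ) * p ^ m ≤ ((N.card : ℝ) ^ m / m.factorial) * p ^ m := by
        gcongr
    _ = _ := by rw [mul_pow]; ring

lemma PP_deg_le {p : ℝ} (h0 : 0 ≤ p) (h1 : p ≤ 1) {K : Finset β} (s : ℕ)
    {N : Finset β} (hN : N ⊆ K) :
    PP p K (fun H => s ≤ (H ∩ N).card) ≤ (p * N.card) ^ s / (s.factorial : ℝ) := by
  refine le_trans (PP_mono h0 h1 ?_) (PP_exists_superset_le h0 h1 s hN)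
  intro H hH hs
  obtain ⟨T, hT, hc⟩ := Finset.exists_subset_card_eq hs
  exact ⟨T, hT.trans Finset.inter_subset_left, hT.trans Finset.inter_subset_right, hc⟩

end PartOne

lemma hprob_eq_PP (n k : ℕ) (p : ℝ) (P : Finset (Finset (Fin n)) → Prop) :
    hprob n k p P = PP p (kSets n k) P := by
  unfold hprob PP EE
  apply Finset.sum_congr rfl
  intro H _
  by_cases h : P H
  · have e1 := ind_pos h
    simp only [e1, if_pos h, mul_one]
  · have e1 := ind_neg h
    simp only [e1, if_neg h, mul_zero]
section PartTwo

set_option linter.unusedSectionVars false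

variable {α : Type*} [DecidableEq α]

open Classical in
/-- Number of `j`-subsets of `V` satisfying `E`. -/
noncomputable def cnt (V : Finset α) (j : ℕ) (E : Finset α → Prop) : ℕ :=
  ((V.powersetCard j).filter E).card

lemma cnt_mono (V : Finset α) (j : ℕ) {E E' : Finset α → Prop}
    (h : ∀ B ⊆ V, B.card = j → E B → E' B) :
    cnt V j E ≤ cnt V j E' := by
  classical
  unfold cnt
  apply Finset.card_le_card
  intro B hB
  rw [Finset.mem_filter] at hB ⊢
  obtain ⟨h1, h2⟩ := Finset.mem_powersetCard.1 hB.1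
  exact ⟨hB.1, h B h1 h2 hB.2⟩

lemma cnt_le_sum (V : Finset α) (j : ℕ) {ι : Type*} (I : Finset ι) {E : Finset α → Prop}
    {E' : ι → Finset α → Prop}
    (h : ∀ B ⊆ V, B.card = j → E B → ∃ i ∈ I, E' i B) :
    cnt V j E ≤ ∑ i ∈ I, cnt V j (E' i) := by
  classical
  unfold cnt
  refine le_trans (Finset.card_le_card ?_) Finset.card_biUnion_le
  intro B hB
  rw [Finset.mem_filter] at hB
  obtain ⟨h1, h2⟩ := Finset.mem_powersetCard.1 hB.1
  obtain ⟨i, hi, hE⟩ := h B h1 h2 hB.2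
  exact Finset.mem_biUnion.2 ⟨i, hi, Finset.mem_filter.2 ⟨hB.1, hE⟩⟩

lemma cnt_local (U : Finset α) (j : ℕ) (E : Finset α → Prop)
    (hE : ∀ A B : Finset α, A ⊆ B → E A → E B) :
    cnt U j E * (U.card - j) ≤ cnt U (j + 1) E * (j + 1) := by
  classical
  unfold cnt
  apply Finset.card_mul_le_card_mul (fun A B : Finset α => A ⊆ B)
  · intro A hA
    rw [Finset.mem_filter, Finset.mem_powersetCard] at hA
    obtain ⟨⟨hAU, hAc⟩, hEA⟩ := hA
    have hinj : Set.InjOn (fun a => insert a A) ((U \ A : Finset α) : Set α) := by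
      intro a ha b hb hab
      have ha' := (Finset.mem_sdiff.1 (Finset.mem_coe.1 ha)).2
      have : a ∈ insert b A := by
        have h : insert a A = insert b A := hab
        rw [← h]; exact Finset.mem_insert_self _ _
      rcases Finset.mem_insert.1 this with h | h
      · exact h
      · exact absurd h ha'
    have hc : ((U \ A).image (fun a => insert a A)).card = U.card - j := by
      rw [Finset.card_image_of_injOn hinj, Finset.card_sdiff_of_subset hAU, hAc]
    rw [← hc]
    apply Finset.card_le_card
    intro B hB
    obtain ⟨a, ha, rfl⟩ := Finset.mem_image.1 hB
    obtain ⟨haU, haA⟩ := Finset.mem_sdiff.1 ha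
    rw [Finset.mem_bipartiteAbove, Finset.mem_filter, Finset.mem_powersetCard]
    refine ⟨⟨⟨Finset.insert_subset haU hAU, ?_⟩, hE _ _ (Finset.subset_insert _ _) hEA⟩,
      Finset.subset_insert _ _⟩
    rw [Finset.card_insert_of_notMem haA, hAc]
  · intro B hB
    rw [Finset.mem_filter, Finset.mem_powersetCard] at hB
    have hc : (B.powersetCard j).card = j + 1 := by
      rw [Finset.card_powersetCard, hB.1.2, Nat.choose_succ_self_right]
    rw [← hc]
    apply Finset.card_le_card
    intro A hA
    rw [Finset.mem_bipartiteBelow, Finset.mem_filter, Finset.mem_powersetCard] at hA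
    exact Finset.mem_powersetCard.2 ⟨hA.2, hA.1.1.2⟩

lemma cnt_insert (U : Finset α) (v : α) (hv : v ∉ U) (j : ℕ) (E : Finset α → Prop)
    (hE : ∀ B : Finset α, E (insert v B) → E B) :
    cnt (insert v U) (j + 1) E ≤ cnt U (j + 1) E + cnt U j E := by
  classical
  unfold cnt
  rw [Finset.powersetCard_succ_insert hv, Finset.filter_union]
  refine (Finset.card_union_le _ _).trans ?_
  apply Nat.add_le_add_left
  have : ((U.powersetCard j).image (insert v)).filter E
      ⊆ ((U.powersetCard j).filter E).image (insert v) := by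
    intro B hB
    obtain ⟨h1, h2⟩ := Finset.mem_filter.1 hB
    obtain ⟨A, hA, rfl⟩ := Finset.mem_image.1 h1
    exact Finset.mem_image.2 ⟨A, Finset.mem_filter.2 ⟨hA, hE _ h2⟩, rfl⟩
  exact (Finset.card_le_card this).trans Finset.card_image_le

lemma cnt_step (U : Finset α) (v : α) (hv : v ∉ U) (j : ℕ) (E : Finset α → Prop)
    (hE : ∀ A B : Finset α, A ⊆ B → E A → E B)
    (hEv : ∀ B : Finset α, E (insert v B) → E B) :
    cnt (insert v U) j E * U.card.choose j ≤ cnt U j E * (insert v U).card.choose j := by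
  rw [Finset.card_insert_of_notMem hv]
  cases j with
  | zero => simp [cnt]
  | succ j =>
    have h1 := cnt_insert U v hv j E hEv
    have h2 := cnt_local U j E hE
    have h3 := Nat.choose_succ_right_eq U.card j
    have h4 : cnt U j E * U.card.choose (j + 1) ≤ cnt U (j + 1) E * U.card.choose j := by
      apply Nat.le_of_mul_le_mul_right (c := j + 1) _ (Nat.succ_pos j)
      calc cnt U j E * U.card.choose (j + 1) * (j + 1)
          = (cnt U j E * (U.card - j)) * U.card.choose j := by
            rw [mul_assoc, h3]; ring
        _ ≤ (cnt U (j + 1) E * (j + 1)) * U.card.choose j := Nat.mul_le_mul_right _ h2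
        _ = _ := by ring
    rw [Nat.choose_succ_succ]
    calc _ ≤ (cnt U (j + 1) E + cnt U j E) * U.card.choose (j + 1) := Nat.mul_le_mul_right _ h1
      _ ≤ _ := by
        rw [add_mul, mul_add]
        simp only [Nat.succ_eq_add_one]
        omega

lemma cnt_union (A U : Finset α) (hd : Disjoint A U) (j : ℕ) (E : Finset α → Prop)
    (hE : ∀ A B : Finset α, A ⊆ B → E A → E B)
    (hEv : ∀ v ∈ A, ∀ B : Finset α, E (insert v B) → E B) :
    cnt (A ∪ U) j E * U.card.choose j ≤ cnt U j E * (A ∪ U).card.choose j := by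
  induction A using Finset.induction_on with
  | empty => simp
  | insert v s hv ih =>
    have hd' : Disjoint s U := hd.mono_left (Finset.subset_insert _ _)
    have hvU : v ∉ U := Finset.disjoint_left.1 hd (Finset.mem_insert_self _ _)
    have h1 := ih hd' (fun w hw => hEv w (Finset.mem_insert_of_mem hw))
    have h2 := cnt_step (s ∪ U) v (by simp [hv, hvU]) j E hE
      (hEv v (Finset.mem_insert_self _ _))
    rw [Finset.insert_union]
    rcases Nat.eq_zero_or_pos ((s ∪ U).card.choose j) with h0 | h0
    · have : U.card.choose j = 0 := by
        have := Nat.choose_le_choose j (Finset.card_le_card (Finset.subset_union_right (s₁ := s) (s₂ := U)))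
        omega
      simp [this]
    · apply Nat.le_of_mul_le_mul_right (c := (s ∪ U).card.choose j) _ h0
      calc cnt (insert v (s ∪ U)) j E * U.card.choose j * (s ∪ U).card.choose j
          = (cnt (insert v (s ∪ U)) j E * (s ∪ U).card.choose j) * U.card.choose j := by ring
        _ ≤ (cnt (s ∪ U) j E * (insert v (s ∪ U)).card.choose j) * U.card.choose j :=
            Nat.mul_le_mul_right _ h2
        _ = (cnt (s ∪ U) j E * U.card.choose j) * (insert v (s ∪ U)).card.choose j := by ring
        _ ≤ (cnt U j E * (s ∪ U).card.choose j) * (insert v (s ∪ U)).card.choose j :=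
            Nat.mul_le_mul_right _ h1
        _ = _ := by ring

variable [Fintype α]

/-- Probability that a uniform `j`-set meets `D`. -/
noncomputable def hitp (j : ℕ) (D : Finset α) : ℝ :=
  (cnt (Finset.univ : Finset α) j (fun B => (B ∩ D).Nonempty) : ℝ) /
    ((Fintype.card α).choose j : ℝ)

lemma hitp_nonneg (j : ℕ) (D : Finset α) : 0 ≤ hitp j D := by
  unfold hitp; positivity

lemma cnt_miss (V : Finset α) (j : ℕ) (E : Finset α → Prop) (D : Finset α) :
    cnt V j (fun B => E B ∧ (B ∩ D).Nonempty) + cnt (V \ D) j E = cnt V j E := by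
  classical
  unfold cnt
  rw [← Finset.card_filter_add_card_filter_not (s := (V.powersetCard j).filter E)
    (fun B => (B ∩ D).Nonempty), Finset.filter_filter, Finset.filter_filter]
  have h2 : (Finset.powersetCard j (V \ D)).filter E
      = (Finset.powersetCard j V).filter (fun a => E a ∧ ¬(a ∩ D).Nonempty) := by
    ext B
    simp only [Finset.mem_filter, Finset.mem_powersetCard, Finset.not_nonempty_iff_eq_empty,
      ← Finset.disjoint_iff_inter_eq_empty, Finset.subset_sdiff]
    tauto
  rw [h2]
  congr!

lemma cnt_true (V : Finset α) (j : ℕ) : cnt V j (fun _ => True) = V.card.choose j := by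
  classical
  unfold cnt
  simp

lemma hitp_eq (j : ℕ) (hj : j ≤ Fintype.card α) (D : Finset α) :
    hitp j D = 1 - ((Fintype.card α - D.card).choose j : ℝ) / ((Fintype.card α).choose j : ℝ) := by
  have h := cnt_miss (Finset.univ : Finset α) j (fun _ => True) D
  rw [cnt_true, cnt_true, ← Finset.compl_eq_univ_sdiff, Finset.card_compl, Finset.card_univ] at h
  simp only [true_and] at h
  have hpos : (0 : ℝ) < ((Fintype.card α).choose j : ℝ) := by
    exact_mod_cast Nat.choose_pos hj
  have h' : (cnt (Finset.univ : Finset α) j (fun B => (B ∩ D).Nonempty) : ℝ)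
      + ((Fintype.card α - D.card).choose j : ℝ) = ((Fintype.card α).choose j : ℝ) := by
    exact_mod_cast h
  unfold hitp
  field_simp
  linarith

lemma hitp_mono (j : ℕ) {D D' : Finset α} (h : D ⊆ D') : hitp j D ≤ hitp j D' := by
  unfold hitp
  gcongr
  apply cnt_mono
  intro B _ _ hB
  exact hB.mono (Finset.inter_subset_inter_left h)

/-- Negative correlation of the hitting events of disjoint sets. -/
lemma cnt_hit_all {ι : Type*} [DecidableEq ι] (I : Finset ι) (D : ι → Finset α)
    (hD : ∀ i ∈ I, ∀ i' ∈ I, i ≠ i' → Disjoint (D i) (D i')) (j : ℕ)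
    (hj : j ≤ Fintype.card α) :
    (cnt (Finset.univ : Finset α) j (fun B => ∀ i ∈ I, (B ∩ D i).Nonempty) : ℝ)
      ≤ ((Fintype.card α).choose j : ℝ) * ∏ i ∈ I, hitp j (D i) := by
  induction I using Finset.induction_on with
  | empty =>
    simp [cnt_true]
  | insert a s ha ih =>
    have ih' := ih (fun i hi i' hi' => hD i (Finset.mem_insert_of_mem hi) i'
      (Finset.mem_insert_of_mem hi'))
    rw [Finset.prod_insert ha]
    set E : Finset α → Prop := fun B => ∀ i ∈ s, (B ∩ D i).Nonempty with hEdef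
    have e1 : cnt (Finset.univ : Finset α) j (fun B => ∀ i ∈ insert a s, (B ∩ D i).Nonempty)
        ≤ cnt (Finset.univ : Finset α) j (fun B => E B ∧ (B ∩ D a).Nonempty) := by
      apply cnt_mono
      intro B _ _ h
      exact ⟨fun i hi => h i (Finset.mem_insert_of_mem hi), h a (Finset.mem_insert_self _ _)⟩
    have e2 := cnt_miss (Finset.univ : Finset α) j E (D a)
    have e3 := cnt_union (D a) (Finset.univ \ D a) Finset.disjoint_sdiff j E
      (fun A B hAB h i hi => (h i hi).mono (Finset.inter_subset_inter_right hAB))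
      (by
        intro v hv B h i hi
        obtain ⟨w, hw⟩ := h i hi
        rw [Finset.mem_inter, Finset.mem_insert] at hw
        refine ⟨w, Finset.mem_inter.2 ⟨?_, hw.2⟩⟩
        rcases hw.1 with h | h
        · subst h
          have hne : a ≠ i := fun h => ha (h ▸ hi)
          exact absurd hw.2 (Finset.disjoint_left.1
            (hD a (Finset.mem_insert_self _ _) i (Finset.mem_insert_of_mem hi) hne) hv)
        · exact h)
    rw [Finset.union_sdiff_of_subset (Finset.subset_univ _)] at e3
    have hc : (Finset.univ \ D a).card = Fintype.card α - (D a).card := by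
      rw [← Finset.compl_eq_univ_sdiff, Finset.card_compl]
    rw [hc, Finset.card_univ] at e3
    have hpos : (0 : ℝ) < ((Fintype.card α).choose j : ℝ) := by
      exact_mod_cast Nat.choose_pos hj
    have e1' : (cnt (Finset.univ : Finset α) j (fun B => ∀ i ∈ insert a s, (B ∩ D i).Nonempty) : ℝ)
        ≤ (cnt (Finset.univ : Finset α) j (fun B => E B ∧ (B ∩ D a).Nonempty) : ℝ) := by
      exact_mod_cast e1
    have e2' : (cnt (Finset.univ : Finset α) j (fun B => E B ∧ (B ∩ D a).Nonempty) : ℝ)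
      + (cnt (Finset.univ \ D a) j E : ℝ) = (cnt Finset.univ j E : ℝ) := by exact_mod_cast e2
    have e3' : (cnt Finset.univ j E : ℝ) * ((Fintype.card α - (D a).card).choose j : ℝ)
      ≤ (cnt (Finset.univ \ D a) j E : ℝ) * ((Fintype.card α).choose j : ℝ) := by
        exact_mod_cast e3
    have e4 : (cnt Finset.univ j E : ℝ) *
        (((Fintype.card α - (D a).card).choose j : ℝ) / ((Fintype.card α).choose j : ℝ))
        ≤ (cnt (Finset.univ \ D a) j E : ℝ) := by
      rw [← mul_div_assoc, div_le_iff₀ hpos]; exact e3'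
    calc _ ≤ (cnt Finset.univ j E : ℝ) * hitp j (D a) := by
          rw [hitp_eq j hj, mul_sub, mul_one]; linarith
      _ ≤ (((Fintype.card α).choose j : ℝ) * ∏ i ∈ s, hitp j (D i)) * hitp j (D a) :=
          mul_le_mul_of_nonneg_right ih' (hitp_nonneg _ _)
      _ = _ := by ring

lemma hitp_singleton (j : ℕ) (hj : j ≤ Fintype.card α) (v : α) :
    hitp j ({v} : Finset α) = (j : ℝ) / (Fintype.card α : ℝ) := by
  rw [hitp_eq j hj, Finset.card_singleton]
  have hn : 0 < Fintype.card α := Fintype.card_pos_iff.2 ⟨v⟩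
  obtain ⟨m, hm⟩ := Nat.exists_eq_succ_of_ne_zero hn.ne'
  rw [hm] at hj ⊢
  have hpos : (0 : ℝ) < ((m + 1).choose j : ℝ) := by
    exact_mod_cast Nat.choose_pos hj
  have h2 : (m + 1) * m.choose j = (m + 1).choose j * (m + 1 - j) := by
    exact (Nat.choose_mul_succ_eq m j) ▸ (mul_comm _ _)
  have h3 : ((m : ℝ) + 1) * (m.choose j : ℝ) = ((m + 1).choose j : ℝ) * ((m : ℝ) + 1 - j) := by
    have : ((m + 1 - j : ℕ) : ℝ) = (m : ℝ) + 1 - j := by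
      rw [Nat.cast_sub hj]; push_cast; ring
    rw [← this]; exact_mod_cast h2
  simp only [Nat.succ_eq_add_one, Nat.add_sub_cancel] at *
  push_cast
  field_simp
  linarith

end PartTwo
section PartThree

lemma kSets_card (n k : ℕ) : (kSets n k).card = n.choose k := by
  simp [kSets]

lemma mem_kSets {n k : ℕ} {A : Finset (Fin n)} : A ∈ kSets n k ↔ A.card = k := by
  simp [kSets, Finset.mem_powersetCard]

lemma card_filter_kSets {n k : ℕ} (E : Finset (Fin n) → Prop) [DecidablePred E] :
    ((kSets n k).filter E).card = cnt (Finset.univ : Finset (Fin n)) k E := by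
  unfold kSets cnt
  congr!

lemma interProb_eq {n k : ℕ} (hk : k ≤ n) :
    interProb n k = 1 - ((n - k).choose k : ℝ) / (n.choose k : ℝ) := by
  classical
  have hpos : (0 : ℝ) < (n.choose k : ℝ) := by exact_mod_cast Nat.choose_pos hk
  have h1 : ∀ A ∈ kSets n k,
      (((kSets n k).filter (fun B => (A ∩ B).Nonempty)).card : ℝ)
        = (n.choose k : ℝ) * (1 - ((n - k).choose k : ℝ) / (n.choose k : ℝ)) := by
    intro A hA
    rw [card_filter_kSets]
    have h := hitp_eq (α := Fin n) k (by simpa using hk) A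
    rw [mem_kSets.1 hA, Fintype.card_fin] at h
    rw [← h, hitp, Fintype.card_fin]
    field_simp
    simp only [Finset.inter_comm]
  have h2 : ((((kSets n k) ×ˢ (kSets n k)).filter fun AB => (AB.1 ∩ AB.2).Nonempty).card : ℝ)
      = ∑ A ∈ kSets n k, (((kSets n k).filter (fun B => (A ∩ B).Nonempty)).card : ℝ) := by
    rw [Finset.card_filter, Finset.sum_product]
    push_cast
    apply Finset.sum_congr rfl
    intro A _
    rw [Finset.card_filter]
    push_cast
    rfl
  unfold interProb
  rw [show ((((kSets n k) ×ˢ (kSets n k)).filter fun AB => (AB.1 ∩ AB.2).Nonempty).card : ℝ)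
      = (n.choose k : ℝ) * ((n.choose k : ℝ) * (1 - ((n - k).choose k : ℝ) / (n.choose k : ℝ))) by
    rw [h2, Finset.sum_congr rfl h1, Finset.sum_const, kSets_card, nsmul_eq_mul], kSets_card]
  field_simp

lemma hitp_le_interProb {n k : ℕ} (hk : k ≤ n) {D A : Finset (Fin n)} (hA : A.card = k)
    (hD : D ⊆ A) : hitp k D ≤ interProb n k := by
  refine (hitp_mono k hD).trans ?_
  rw [hitp_eq k (by simpa using hk), interProb_eq hk, hA, Fintype.card_fin]

lemma card_supersets_le {n k : ℕ} (hk : k ≤ n) (Y : Finset (Fin n)) :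
    (((kSets n k).filter (fun A => Y ⊆ A)).card : ℝ)
      ≤ (n.choose k : ℝ) * ((k : ℝ) / n) ^ Y.card := by
  classical
  rw [card_filter_kSets]
  have h := cnt_hit_all (α := Fin n) Y (fun v => ({v} : Finset (Fin n)))
    (by intro i _ i' _ h; simpa using h) k (by simpa using hk)
  have h2 : ∀ i ∈ Y, hitp k ({i} : Finset (Fin n)) = (k : ℝ) / n := by
    intro i _
    rw [hitp_singleton k (by simpa using hk), Fintype.card_fin]
  rw [Finset.prod_congr rfl h2, Finset.prod_const, Fintype.card_fin] at h
  refine le_trans ?_ h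
  exact_mod_cast cnt_mono _ _ (by
    intro B _ _ hB i hi
    exact ⟨i, by simp [hB hi]⟩)

lemma PP_codeg_le {n k : ℕ} (hk : k ≤ n) {p : ℝ} (h0 : 0 ≤ p) (h1 : p ≤ 1) (y s : ℕ) :
    PP p (kSets n k) (fun H => ∃ Y : Finset (Fin n), Y.card = y ∧
        s ≤ (H.filter (fun A => Y ⊆ A)).card)
      ≤ (n.choose y : ℝ) * ((p * (n.choose k : ℝ) * ((k : ℝ) / n) ^ y) ^ s / (s.factorial : ℝ)) := by
  classical
  have h := PP_le_sum h0 h1 (K := kSets n k)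
    (P := fun H => ∃ Y : Finset (Fin n), Y.card = y ∧ s ≤ (H.filter (fun A => Y ⊆ A)).card)
    ((Finset.univ : Finset (Fin n)).powersetCard y)
    (Q := fun Y H => s ≤ (H ∩ (kSets n k).filter (fun A => Y ⊆ A)).card) (by
      rintro H hH ⟨Y, hY, hs⟩
      refine ⟨Y, by simp [Finset.mem_powersetCard, hY], hs.trans (Finset.card_le_card ?_)⟩
      intro A hA
      obtain ⟨h1, h2⟩ := Finset.mem_filter.1 hA
      exact Finset.mem_inter.2 ⟨h1, Finset.mem_filter.2 ⟨hH h1, h2⟩⟩)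
  refine h.trans ?_
  have h3 : ∀ Y ∈ (Finset.univ : Finset (Fin n)).powersetCard y,
      PP p (kSets n k) (fun H => s ≤ (H ∩ (kSets n k).filter (fun A => Y ⊆ A)).card)
      ≤ (p * (n.choose k : ℝ) * ((k : ℝ) / n) ^ y) ^ s / (s.factorial : ℝ) := by
    intro Y hY
    refine (PP_deg_le h0 h1 s (Finset.filter_subset _ _)).trans ?_
    have := card_supersets_le hk Y
    rw [(Finset.mem_powersetCard.1 hY).2] at this
    rw [mul_assoc]
    gcongr
  refine (Finset.sum_le_sum h3).trans ?_
  rw [Finset.sum_const, Finset.card_powersetCard, nsmul_eq_mul, Finset.card_univ, Fintype.card_fin]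

lemma mubar_eq {n k : ℕ} (hk : 1 ≤ k) (hkn : k ≤ n) (p : ℝ) :
    mubar n k p = p * (n.choose k : ℝ) := by
  unfold mubar phi
  obtain ⟨n, rfl⟩ : ∃ m, n = m + 1 := ⟨n - 1, by omega⟩
  obtain ⟨k, rfl⟩ : ∃ m, k = m + 1 := ⟨k - 1, by omega⟩
  have h := Nat.add_one_mul_choose_eq n k
  have h' : ((n : ℝ) + 1) * (n.choose k : ℝ) = ((n + 1).choose (k + 1) : ℝ) * ((k : ℝ) + 1) := by
    exact_mod_cast h
  simp only [Nat.add_sub_cancel]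
  push_cast
  have : (k : ℝ) + 1 ≠ 0 := by positivity
  field_simp
  linear_combination (p * h')

lemma spacer_true : True := trivial

/-- The number of `k`-sets avoiding `x` and meeting all of a well-behaved family. -/
lemma cross_count {n k : ℕ} (hk : k ≤ n) (x : Fin n) (S : Finset (Finset (Fin n)))
    (hS : ∀ A ∈ S, A.card = k) (c l : ℕ)
    (hc : ∀ y, y ≠ x → (S.filter (fun A => y ∈ A)).card ≤ c)
    (hl : ∀ A ∈ S, ∀ A' ∈ S, A ≠ A' → (A ∩ A').card ≤ l)
    (hq0 : 0 < interProb n k) (hq1 : interProb n k ≤ 1)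
    (hsmall : (S.card : ℝ) ^ 2 * l * ((k : ℝ) / n * (interProb n k ^ c)⁻¹) ≤ 1) :
    (cnt (Finset.univ : Finset (Fin n)) k (fun B => x ∉ B ∧ ∀ A ∈ S, (B ∩ A).Nonempty) : ℝ)
      ≤ 3 * (n.choose k : ℝ) * interProb n k ^ S.card := by
  classical
  set q := interProb n k with hq
  set W : Finset (Fin n) := S.offDiag.biUnion (fun P => (P.1 ∩ P.2).erase x) with hW
  have hWc : (W.card : ℝ) ≤ (S.card : ℝ) ^ 2 * l := by
    have h1 : W.card ≤ S.offDiag.card * l := by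
      apply Finset.card_biUnion_le_card_mul
      intro P hP
      obtain ⟨h1, h2, h3⟩ := Finset.mem_offDiag.1 hP
      exact (Finset.card_erase_le).trans (hl _ h1 _ h2 h3)
    have h2 : S.offDiag.card ≤ S.card ^ 2 := by
      rw [Finset.offDiag_card, sq]; exact Nat.sub_le _ _
    exact_mod_cast h1.trans (Nat.mul_le_mul_right _ h2)
  let IR : Finset (Fin n) → Finset (Finset (Fin n)) := fun R => S.filter (fun A => Disjoint A R)
  let D : Fin n ⊕ Finset (Fin n) → Finset (Fin n) :=
    Sum.elim (fun v => {v}) (fun A => A.erase x \ W)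
  have hIR : ∀ R ⊆ W, S.card ≤ (IR R).card + c * R.card := by
    intro R hR
    have h1 : S ⊆ IR R ∪ R.biUnion (fun y => S.filter (fun A => y ∈ A)) := by
      intro A hA
      by_cases hd : Disjoint A R
      · exact Finset.mem_union_left _ (Finset.mem_filter.2 ⟨hA, hd⟩)
      · apply Finset.mem_union_right
        obtain ⟨y, hy1, hy2⟩ := Finset.not_disjoint_iff.1 hd
        exact Finset.mem_biUnion.2 ⟨y, hy2, Finset.mem_filter.2 ⟨hA, hy1⟩⟩
    refine (Finset.card_le_card h1).trans ((Finset.card_union_le _ _).trans ?_)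
    apply Nat.add_le_add_left
    rw [mul_comm]
    apply Finset.card_biUnion_le_card_mul
    intro y hy
    apply hc
    rintro rfl
    obtain ⟨P, _, h2⟩ := Finset.mem_biUnion.1 (hR hy)
    exact Finset.notMem_erase _ _ h2
  have hcount : (cnt (Finset.univ : Finset (Fin n)) k
      (fun B => x ∉ B ∧ ∀ A ∈ S, (B ∩ A).Nonempty) : ℝ)
      ≤ ∑ R ∈ W.powerset, (cnt (Finset.univ : Finset (Fin n)) k
        (fun B => ∀ i ∈ R.disjSum (IR R), (B ∩ D i).Nonempty) : ℝ) := by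
    have : cnt (Finset.univ : Finset (Fin n)) k
      (fun B => x ∉ B ∧ ∀ A ∈ S, (B ∩ A).Nonempty)
      ≤ ∑ R ∈ W.powerset, cnt (Finset.univ : Finset (Fin n)) k
        (fun B => ∀ i ∈ R.disjSum (IR R), (B ∩ D i).Nonempty) := by
      apply cnt_le_sum
      rintro B _ _ ⟨h2, h3⟩
      refine ⟨B ∩ W, Finset.mem_powerset.2 Finset.inter_subset_right, ?_⟩
      intro i hi
      rcases i with v | A
      · have hv := Finset.inl_mem_disjSum.1 hi
        refine ⟨v, Finset.mem_inter.2 ⟨(Finset.mem_inter.1 hv).1, ?_⟩⟩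
        simp [D]
      · have hA := Finset.inr_mem_disjSum.1 hi
        obtain ⟨hAS, hAd⟩ := Finset.mem_filter.1 hA
        obtain ⟨u, hu⟩ := h3 A hAS
        obtain ⟨huB, huA⟩ := Finset.mem_inter.1 hu
        refine ⟨u, Finset.mem_inter.2 ⟨huB, ?_⟩⟩
        simp only [D, Sum.elim_inr]
        refine Finset.mem_sdiff.2 ⟨Finset.mem_erase.2 ⟨?_, huA⟩, ?_⟩
        · rintro rfl; exact h2 huB
        · intro huW
          exact Finset.disjoint_left.1 hAd huA (Finset.mem_inter.2 ⟨huB, huW⟩)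
    exact_mod_cast this
  set z : ℝ := (k : ℝ) / n * (q ^ c)⁻¹ with hz
  have hz0 : 0 ≤ z := by positivity
  have hterm : ∀ R ∈ W.powerset, (cnt (Finset.univ : Finset (Fin n)) k
        (fun B => ∀ i ∈ R.disjSum (IR R), (B ∩ D i).Nonempty) : ℝ)
        ≤ (n.choose k : ℝ) * q ^ S.card * (z ^ R.card * 1 ^ (W.card - R.card)) := by
    intro R hR
    have hRW := Finset.mem_powerset.1 hR
    have h := cnt_hit_all (α := Fin n) (R.disjSum (IR R)) D (by
      intro i hi i' hi' hne
      rcases i with v | A <;> rcases i' with v' | A'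
      · simp only [D, Sum.elim_inl]
        rw [Finset.disjoint_singleton]
        rintro rfl; exact hne rfl
      · have hv := hRW (Finset.inl_mem_disjSum.1 hi)
        simp only [D, Sum.elim_inl, Sum.elim_inr, Finset.disjoint_singleton_left]
        intro h; exact (Finset.mem_sdiff.1 h).2 hv
      · have hv := hRW (Finset.inl_mem_disjSum.1 hi')
        simp only [D, Sum.elim_inl, Sum.elim_inr, Finset.disjoint_singleton_right]
        intro h; exact (Finset.mem_sdiff.1 h).2 hv
      · have hA := (Finset.mem_filter.1 (Finset.inr_mem_disjSum.1 hi)).1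
        have hA' := (Finset.mem_filter.1 (Finset.inr_mem_disjSum.1 hi')).1
        simp only [D, Sum.elim_inr]
        rw [Finset.disjoint_left]
        intro u hu hu'
        obtain ⟨h1, h2⟩ := Finset.mem_sdiff.1 hu
        obtain ⟨h3, _⟩ := Finset.mem_sdiff.1 hu'
        obtain ⟨hux, huA⟩ := Finset.mem_erase.1 h1
        obtain ⟨_, huA'⟩ := Finset.mem_erase.1 h3
        apply h2
        exact Finset.mem_biUnion.2 ⟨(A, A'), Finset.mem_offDiag.2
          ⟨hA, hA', fun h => hne (by rw [show A = A' from h])⟩,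
          Finset.mem_erase.2 ⟨hux, Finset.mem_inter.2 ⟨huA, huA'⟩⟩⟩) k (by simpa using hk)
    refine h.trans ?_
    rw [Finset.prod_disjSum, Fintype.card_fin, one_pow, mul_one]
    have e1 : ∏ v ∈ R, hitp k (D (Sum.inl v)) = ((k : ℝ) / n) ^ R.card := by
      rw [← Finset.prod_const]
      apply Finset.prod_congr rfl
      intro v _
      simp only [D, Sum.elim_inl]
      rw [hitp_singleton k (by simpa using hk), Fintype.card_fin]
    have e2 : ∏ A ∈ IR R, hitp k (D (Sum.inr A)) ≤ q ^ (IR R).card := by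
      rw [← Finset.prod_const]
      apply Finset.prod_le_prod
      · intro A _; exact hitp_nonneg _ _
      · intro A hA
        simp only [D, Sum.elim_inr]
        exact hitp_le_interProb hk (hS A (Finset.mem_filter.1 hA).1)
          (Finset.sdiff_subset.trans (Finset.erase_subset _ _))
    have e3 : q ^ (IR R).card ≤ q ^ S.card * ((q ^ c)⁻¹) ^ R.card := by
      rw [inv_pow, ← pow_mul, ← div_eq_mul_inv, le_div_iff₀ (by positivity), ← pow_add]
      exact pow_le_pow_of_le_one hq0.le hq1 (hIR R hRW)
    rw [e1]
    calc (n.choose k : ℝ) * (((k : ℝ) / n) ^ R.card * ∏ A ∈ IR R, hitp k (D (Sum.inr A)))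
        ≤ (n.choose k : ℝ) * (((k : ℝ) / n) ^ R.card * (q ^ S.card * ((q ^ c)⁻¹) ^ R.card)) := by
          gcongr
          exact e2.trans e3
      _ = _ := by rw [hz, mul_pow]; ring
  refine hcount.trans ((Finset.sum_le_sum hterm).trans ?_)
  rw [← Finset.mul_sum, Finset.sum_pow_mul_eq_add_pow]
  have e4 : (z + 1) ^ W.card ≤ 3 := by
    calc (z + 1) ^ W.card ≤ (Real.exp z) ^ W.card := by
          gcongr; exact Real.add_one_le_exp z
      _ = Real.exp (W.card * z) := by rw [Real.exp_nat_mul]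
      _ ≤ Real.exp 1 := by
          apply Real.exp_le_exp.2
          exact (mul_le_mul_of_nonneg_right hWc hz0).trans hsmall
      _ ≤ 3 := by linarith [Real.exp_one_lt_d9]
  calc (n.choose k : ℝ) * q ^ S.card * (z + 1) ^ W.card
      ≤ (n.choose k : ℝ) * q ^ S.card * 3 := by gcongr
    _ = _ := by ring

end PartThree
section PartFour

lemma card_small_compl {β : Type*} [DecidableEq β] (G : Finset β) (m : ℕ) :
    (G.powerset.filter (fun S => (G \ S).card ≤ m)).card ≤ (G.card + 1) ^ m := by
  have h1 : (G.powerset.filter (fun S => (G \ S).card ≤ m)).card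
      ≤ ((Finset.range (m + 1)).biUnion (fun i => G.powersetCard i)).card := by
    apply Finset.card_le_card_of_injOn (fun S => G \ S)
    · intro S hS
      rw [Finset.mem_coe, Finset.mem_filter] at hS
      rw [Finset.mem_coe, Finset.mem_biUnion]
      exact ⟨(G \ S).card, by simp; omega, Finset.mem_powersetCard.2 ⟨Finset.sdiff_subset, rfl⟩⟩
    · intro S hS S' hS' h
      rw [Finset.mem_coe, Finset.mem_filter, Finset.mem_powerset] at hS hS'
      have h' : G \ S = G \ S' := h
      rw [← Finset.sdiff_sdiff_eq_self hS.1, h', Finset.sdiff_sdiff_eq_self hS'.1]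
  refine h1.trans (Finset.card_biUnion_le.trans ?_)
  rw [add_pow]
  apply Finset.sum_le_sum
  intro i hi
  rw [Finset.card_powersetCard, one_pow, mul_one]
  have h2 : 1 ≤ m.choose i := Nat.choose_pos (by simpa [Nat.lt_succ_iff] using hi)
  calc G.card.choose i ≤ G.card ^ i := Nat.choose_le_pow _ _
    _ ≤ G.card ^ i * m.choose i := Nat.le_mul_of_pos_right _ h2

/-- A well-behaved star. -/
def goodStar {n : ℕ} (x : Fin n) (D c l : ℕ) (G : Finset (Finset (Fin n))) : Prop :=
  G.card ≤ D ∧ (∀ y, y ≠ x → (G.filter (fun A => y ∈ A)).card ≤ c) ∧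
    ∀ A ∈ G, ∀ A' ∈ G, A ≠ A' → (A ∩ A').card ≤ l

/-- The bad event at `x`. -/
def badAt {n : ℕ} (x : Fin n) (D c l t m : ℕ) (H : Finset (Finset (Fin n))) : Prop :=
  goodStar x D c l (starOf H x) ∧ ∃ S ⊆ starOf H x, t ≤ S.card ∧ (starOf H x \ S).card ≤ m ∧
    ∃ T ⊆ H, T.card = m ∧ ∀ B ∈ T, x ∉ B ∧ ∀ A ∈ S, (B ∩ A).Nonempty

lemma card_star {n k : ℕ} (hk1 : 1 ≤ k) (x : Fin n) :
    ((kSets n k).filter (fun A => x ∈ A)).card = (n - 1).choose (k - 1) := by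
  classical
  have hn : 1 ≤ n := by have := x.2; omega
  rw [card_filter_kSets]
  have h := cnt_miss (Finset.univ : Finset (Fin n)) k (fun _ => True) {x}
  rw [cnt_true, cnt_true, ← Finset.compl_eq_univ_sdiff, Finset.card_compl, Finset.card_univ,
    Fintype.card_fin, Finset.card_singleton] at h
  have h2 : cnt (Finset.univ : Finset (Fin n)) k (fun A => x ∈ A)
      = cnt (Finset.univ : Finset (Fin n)) k (fun B => True ∧ (B ∩ {x}).Nonempty) := by
    apply le_antisymm
    · apply cnt_mono
      intro B _ _ hB
      exact ⟨trivial, x, by simp [hB]⟩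
    · apply cnt_mono
      rintro B _ _ ⟨_, u, hu⟩
      simp only [Finset.mem_inter, Finset.mem_singleton] at hu
      exact hu.2 ▸ hu.1
  obtain ⟨n', rfl⟩ : ∃ m, n = m + 1 := ⟨n - 1, by omega⟩
  obtain ⟨k', rfl⟩ : ∃ m, k = m + 1 := ⟨k - 1, by omega⟩
  rw [h2]
  have h3 := Nat.choose_succ_succ n' k'
  simp only [Nat.add_sub_cancel, Nat.succ_eq_add_one] at *
  omega

lemma PP_badAt_le {n k : ℕ} (hk1 : 1 ≤ k) (hk : k ≤ n) {p : ℝ} (h0 : 0 ≤ p) (h1 : p ≤ 1)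
    (x : Fin n) (D c l t m : ℕ)
    (hq0 : 0 < interProb n k) (hq1 : interProb n k ≤ 1)
    (hsmall : (D : ℝ) ^ 2 * l * ((k : ℝ) / n * (interProb n k ^ c)⁻¹) ≤ 1) :
    PP p (kSets n k) (badAt x D c l t m)
      ≤ binomProbGe ((n - 1).choose (k - 1)) p t *
        (((D : ℝ) + 1) * (3 * (p * (n.choose k : ℝ)) * interProb n k ^ t)) ^ m := by
  classical
  set q := interProb n k with hq
  set F := (kSets n k).filter (fun A => x ∈ A) with hF
  set F' := kSets n k \ F with hF'
  set κ : ℝ := (((D : ℝ) + 1) * (3 * (p * (n.choose k : ℝ)) * q ^ t)) ^ m with hκ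
  have hκ0 : 0 ≤ κ := by positivity
  have hFK : F ⊆ kSets n k := Finset.filter_subset _ _
  have hK : kSets n k = F ∪ F' := by rw [Finset.union_sdiff_of_subset hFK]
  have hF'x : ∀ B ∈ F', x ∉ B := by
    intro B hB hx
    obtain ⟨h1, h2⟩ := Finset.mem_sdiff.1 hB
    exact h2 (Finset.mem_filter.2 ⟨h1, hx⟩)
  have hstar : ∀ G ⊆ F, ∀ G' ⊆ F', starOf (G ∪ G') x = G := by
    intro G hG G' hG'
    ext A
    simp only [starOf, Finset.mem_filter, Finset.mem_union]
    constructor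
    · rintro ⟨h | h, h2⟩
      · exact h
      · exact absurd h2 (hF'x _ (hG' h))
    · intro h
      exact ⟨Or.inl h, (Finset.mem_filter.1 (hG h)).2⟩
  have hmain : PP p (kSets n k) (badAt x D c l t m)
      = EE p F (fun G => PP p F' (fun G' => badAt x D c l t m (G ∪ G'))) := by
    unfold PP
    conv_lhs => rw [hK]
    rw [EE_union p F F' Finset.disjoint_sdiff]
  rw [hmain, ← card_star hk1 x, ← PP_card_ge]
  unfold PP
  rw [← EE_mul_const]
  apply EE_mono h0 h1
  intro G hG
  change PP p F' (fun G' => badAt x D c l t m (G ∪ G')) ≤ _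
  by_cases hgood : goodStar x D c l G ∧ t ≤ G.card
  · obtain ⟨⟨hg1, hg2, hg3⟩, hgt⟩ := hgood
    rw [ind_pos hgt, one_mul]
    set 𝒮 := (G.powerset.filter (fun S => (G \ S).card ≤ m)).filter (fun S => t ≤ S.card) with h𝒮
    have hb1 := PP_le_sum h0 h1 (K := F')
      (P := fun G' => badAt x D c l t m (G ∪ G')) 𝒮
      (Q := fun S G' => ∃ T ⊆ G', T ⊆ F'.filter (fun B => x ∉ B ∧ ∀ A ∈ S, (B ∩ A).Nonempty)
        ∧ T.card = m) (by
        rintro G' hG' ⟨_, S, hS, hSt, hSm, T, hT, hTm, hTB⟩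
        rw [hstar G hG G' hG'] at hS hSm
        have hTG : T ⊆ G' := by
          intro B hB
          rcases Finset.mem_union.1 (hT hB) with h | h
          · exact absurd (Finset.mem_filter.1 (hG h)).2 (hTB B hB).1
          · exact h
        refine ⟨S, Finset.mem_filter.2 ⟨Finset.mem_filter.2 ⟨Finset.mem_powerset.2 hS, hSm⟩, hSt⟩,
          T, hTG, ?_, hTm⟩
        intro B hB
        exact Finset.mem_filter.2 ⟨hG' (hTG hB), hTB B hB⟩)
    refine hb1.trans ?_
    have hterm : ∀ S ∈ 𝒮, PP p F' (fun G' => ∃ T ⊆ G',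
        T ⊆ F'.filter (fun B => x ∉ B ∧ ∀ A ∈ S, (B ∩ A).Nonempty) ∧ T.card = m)
        ≤ (3 * (p * (n.choose k : ℝ)) * q ^ t) ^ m := by
      intro S hS
      obtain ⟨hS1, hSt⟩ := Finset.mem_filter.1 hS
      have hSG := Finset.mem_powerset.1 (Finset.mem_filter.1 hS1).1
      refine (PP_exists_superset_le h0 h1 m (Finset.filter_subset _ _)).trans ?_
      have hSc : S.card ≤ D := (Finset.card_le_card hSG).trans hg1
      have hcr := cross_count hk x S
        (fun A hA => mem_kSets.1 (hFK (hG (hSG hA)))) c l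
        (fun y hy => (Finset.card_le_card (Finset.filter_subset_filter _ hSG)).trans (hg2 y hy))
        (fun A hA A' hA' => hg3 A (hSG hA) A' (hSG hA')) hq0 hq1 (by
          refine le_trans ?_ hsmall
          have hSD : (S.card : ℝ) ≤ D := by exact_mod_cast hSc
          have hz0 : 0 ≤ (k : ℝ) / n * (interProb n k ^ c)⁻¹ :=
            mul_nonneg (div_nonneg (Nat.cast_nonneg _) (Nat.cast_nonneg _))
              (inv_nonneg.2 (pow_nonneg hq0.le _))
          exact mul_le_mul_of_nonneg_right (mul_le_mul_of_nonneg_right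
            (pow_le_pow_left₀ (Nat.cast_nonneg _) hSD 2) (Nat.cast_nonneg _)) hz0)
      have hcard : ((F'.filter (fun B => x ∉ B ∧ ∀ A ∈ S, (B ∩ A).Nonempty)).card : ℝ)
          ≤ (cnt (Finset.univ : Finset (Fin n)) k
            (fun B => x ∉ B ∧ ∀ A ∈ S, (B ∩ A).Nonempty) : ℝ) := by
        rw [← card_filter_kSets]
        exact_mod_cast Finset.card_le_card (Finset.filter_subset_filter _ Finset.sdiff_subset)
      have hfac : (1 : ℝ) ≤ (m.factorial : ℝ) := by exact_mod_cast Nat.factorial_pos m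
      refine (div_le_self (pow_nonneg (mul_nonneg h0 (Nat.cast_nonneg _)) _) hfac).trans ?_
      apply pow_le_pow_left₀ (mul_nonneg h0 (Nat.cast_nonneg _))
      calc p * ((F'.filter (fun B => x ∉ B ∧ ∀ A ∈ S, (B ∩ A).Nonempty)).card : ℝ)
          ≤ p * (3 * (n.choose k : ℝ) * q ^ S.card) :=
            mul_le_mul_of_nonneg_left (hcard.trans hcr) h0
        _ ≤ p * (3 * (n.choose k : ℝ) * q ^ t) := by
            have := pow_le_pow_of_le_one hq0.le hq1 hSt
            gcongr
        _ = _ := by ring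
    refine (Finset.sum_le_sum hterm).trans ?_
    rw [Finset.sum_const, nsmul_eq_mul, hκ, mul_pow ((D : ℝ) + 1)]
    apply mul_le_mul_of_nonneg_right _ (by positivity)
    have h5 : 𝒮.card ≤ (D + 1) ^ m :=
      (Finset.card_le_card (Finset.filter_subset _ _)).trans ((card_small_compl G m).trans
        (Nat.pow_le_pow_left (by omega) m))
    exact_mod_cast h5
  · have hz : PP p F' (fun G' => badAt x D c l t m (G ∪ G')) = PP p F' (fun _ => False) := by
      apply EE_congr
      intro G' hG'
      apply ind_congr
      simp only [iff_false]
      rintro ⟨hg, S, hS, hSt, _⟩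
      rw [hstar G hG G' hG'] at hg hS
      exact hgood ⟨hg, hSt.trans (Finset.card_le_card hS)⟩
    rw [hz]
    have : PP p F' (fun _ => False) = 0 := by
      unfold PP
      rw [show (fun H : Finset (Finset (Fin n)) => ind False) = fun _ => 0 from
        funext fun _ => ind_neg id, EE_const]
    rw [this]
    exact mul_nonneg (ind_nonneg _) hκ0

end PartFour
section PartFive

lemma binom_term_nonneg {M : ℕ} {p : ℝ} (h0 : 0 ≤ p) (h1 : p ≤ 1) (j : ℕ) :
    0 ≤ (M.choose j : ℝ) * p ^ j * (1 - p) ^ (M - j) := by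
  have : 0 ≤ 1 - p := by linarith
  positivity

lemma binomProbGe_nonneg {M : ℕ} {p : ℝ} (h0 : 0 ≤ p) (h1 : p ≤ 1) (s : ℕ) :
    0 ≤ binomProbGe M p s :=
  Finset.sum_nonneg fun j _ => binom_term_nonneg h0 h1 j

lemma binomProbGe_anti {M : ℕ} {p : ℝ} (h0 : 0 ≤ p) (h1 : p ≤ 1) {s t : ℕ} (h : s ≤ t) :
    binomProbGe M p t ≤ binomProbGe M p s := by
  unfold binomProbGe
  apply Finset.sum_le_sum_of_subset_of_nonneg
  · exact Finset.Icc_subset_Icc_left h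
  · intro j _ _; exact binom_term_nonneg h0 h1 j

lemma binomProbGe_le_one {M : ℕ} {p : ℝ} (h0 : 0 ≤ p) (h1 : p ≤ 1) (s : ℕ) :
    binomProbGe M p s ≤ 1 := by
  have h := PP_card_ge p (Finset.range M) s
  rw [Finset.card_range] at h
  rw [← h, ← EE_const p (Finset.range M) 1]
  apply EE_mono h0 h1
  intro H _
  unfold ind; split_ifs <;> norm_num

lemma binomProbGe_le {M : ℕ} {p : ℝ} (h0 : 0 ≤ p) (h1 : p ≤ 1) (s : ℕ) :
    binomProbGe M p s ≤ (p * M) ^ s / (s.factorial : ℝ) := by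
  have h := PP_card_ge p (Finset.range M) s
  rw [Finset.card_range] at h
  rw [← h]
  refine le_trans (PP_mono h0 h1 ?_) (le_trans (PP_deg_le h0 h1 s (le_refl (Finset.range M))) ?_)
  · intro H hH hs
    rwa [Finset.inter_eq_left.2 hH]
  · rw [Finset.card_range]

lemma binomProbGe_step {M : ℕ} {p : ℝ} (h0 : 0 ≤ p) (h1 : p ≤ 1) {s : ℕ} {r : ℝ}
    (hr : 0 ≤ r) (hs : s < M) (h : (s : ℝ) + 1 ≤ r * (((M : ℝ) - s) * p)) :
    binomProbGe M p s ≤ (1 + r) * binomProbGe M p (s + 1) := by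
  have e1 : binomProbGe M p s
      = (M.choose s : ℝ) * p ^ s * (1 - p) ^ (M - s) + binomProbGe M p (s + 1) := by
    unfold binomProbGe
    rw [← Finset.insert_Icc_succ_left_eq_Icc hs.le, Finset.sum_insert (by simp)]
    rfl
  set b := (M.choose (s + 1) : ℝ) * p ^ (s + 1) * (1 - p) ^ (M - (s + 1)) with hb
  have hb0 : 0 ≤ b := binom_term_nonneg h0 h1 _
  have e2 : b ≤ binomProbGe M p (s + 1) := by
    unfold binomProbGe
    exact Finset.single_le_sum (f := fun j => (M.choose j : ℝ) * p ^ j * (1 - p) ^ (M - j))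
      (fun j _ => binom_term_nonneg h0 h1 j)
      (Finset.mem_Icc.2 ⟨le_refl _, hs⟩)
  have e3 : (M.choose s : ℝ) * p ^ s * (1 - p) ^ (M - s) ≤ r * b := by
    have hc := Nat.choose_succ_right_eq M s
    have hc' : (M.choose (s + 1) : ℝ) * ((s : ℝ) + 1) = (M.choose s : ℝ) * ((M : ℝ) - s) := by
      rw [← Nat.cast_sub hs.le]; exact_mod_cast hc
    have hpow : (1 - p) ^ (M - s) = (1 - p) ^ (M - (s + 1)) * (1 - p) := by
      rw [← pow_succ]; congr 1; omega
    have hpos : (0 : ℝ) < ((M : ℝ) - s) * p := by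
      by_contra hneg
      push Not at hneg
      have : r * (((M : ℝ) - s) * p) ≤ 0 := mul_nonpos_of_nonneg_of_nonpos hr hneg
      have : (0 : ℝ) ≤ s := Nat.cast_nonneg _
      linarith
    have e4 : (M.choose s : ℝ) * p ^ s * (1 - p) ^ (M - s) * (((M : ℝ) - s) * p)
        = b * ((s : ℝ) + 1) * (1 - p) := by
      rw [hb, hpow, pow_succ]
      linear_combination (-(p ^ s * p * (1 - p) ^ (M - (s + 1)) * (1 - p))) * hc'
    have e5 : b * ((s : ℝ) + 1) * (1 - p) ≤ (r * b) * (((M : ℝ) - s) * p) := by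
      calc b * ((s : ℝ) + 1) * (1 - p) ≤ b * ((s : ℝ) + 1) * 1 := by
            apply mul_le_mul_of_nonneg_left (by linarith); positivity
        _ ≤ b * (r * (((M : ℝ) - s) * p)) := by
            rw [mul_one]; exact mul_le_mul_of_nonneg_left h hb0
        _ = _ := by ring
    rw [← e4] at e5
    exact le_of_mul_le_mul_right e5 hpos
  rw [e1]
  nlinarith

lemma binomProbGe_iter {M : ℕ} {p : ℝ} (h0 : 0 ≤ p) (h1 : p ≤ 1) {a : ℕ} {r : ℝ}
    (hr : 0 ≤ r) (hs : a < M) (h : (a : ℝ) + 1 ≤ r * (((M : ℝ) - a) * p)) (i : ℕ) :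
    binomProbGe M p (a + 1 - i) ≤ (1 + r) ^ i * binomProbGe M p (a + 1) := by
  induction i with
  | zero => simp
  | succ i ih =>
    have hB := binomProbGe_nonneg h0 h1 (M := M) (a + 1)
    by_cases hi : i ≤ a
    · have e : a + 1 - i = (a + 1 - (i + 1)) + 1 := by omega
      rw [e] at ih
      have hle : ((a + 1 - (i + 1) : ℕ) : ℝ) ≤ a := by exact_mod_cast (by omega)
      have h2 := binomProbGe_step h0 h1 (M := M) (s := a + 1 - (i + 1)) hr (by omega) (by
        calc ((a + 1 - (i + 1) : ℕ) : ℝ) + 1 ≤ (a : ℝ) + 1 := by linarith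
          _ ≤ r * (((M : ℝ) - a) * p) := h
          _ ≤ _ := by gcongr)
      refine h2.trans ?_
      rw [pow_succ' (1 + r), mul_assoc]
      exact mul_le_mul_of_nonneg_left ih (by linarith)
    · have e : a + 1 - (i + 1) = a + 1 - i := by omega
      rw [e]
      refine ih.trans ?_
      apply mul_le_mul_of_nonneg_right _ hB
      exact pow_le_pow_right₀ (by linarith) (Nat.le_succ i)

lemma binomProbGe_alpha1 {n k : ℕ} {p : ℝ} (hn : 2 ≤ n) {a : ℕ} (ha : alpha1 n k p ≤ a) :
    binomProbGe ((n - 1).choose (k - 1)) p (a + 1) ≤ Real.log n / n := by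
  by_contra hc
  push Not at hc
  have hpos : 0 < Real.log n / n := by
    have : (1 : ℝ) < n := by exact_mod_cast (by omega : 1 < n)
    have := Real.log_pos this
    positivity
  have hbdd : BddAbove {t : ℕ | Real.log n / n ≤ binomProbGe ((n - 1).choose (k - 1)) p t} := by
    refine ⟨(n - 1).choose (k - 1), ?_⟩
    intro t ht
    by_contra hlt
    push Not at hlt
    have : binomProbGe ((n - 1).choose (k - 1)) p t = 0 := by
      unfold binomProbGe
      rw [Finset.Icc_eq_empty (by omega), Finset.sum_empty]
    have ht' : Real.log n / n ≤ binomProbGe ((n - 1).choose (k - 1)) p t := ht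
    linarith
  have := le_csSup hbdd (show a + 1 ∈ _ from hc.le)
  unfold alpha1 at ha
  omega

lemma alpha1_le {n k : ℕ} {p : ℝ} (h0 : 0 ≤ p) (h1 : p ≤ 1) {D : ℕ}
    (h : phi n k p ^ (D + 1) / ((D + 1).factorial : ℝ) < Real.log n / n) :
    alpha1 n k p ≤ D := by
  unfold alpha1
  apply csSup_le'
  intro t ht
  by_contra hlt
  push Not at hlt
  have ht' : Real.log n / n ≤ binomProbGe ((n - 1).choose (k - 1)) p t := ht
  have h2 := binomProbGe_anti h0 h1 (M := (n - 1).choose (k - 1)) (s := D + 1) (t := t) hlt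
  have h3 := binomProbGe_le h0 h1 (M := (n - 1).choose (k - 1)) (D + 1)
  unfold phi at h
  linarith

lemma goodStar_of {n k : ℕ} {H : Finset (Finset (Fin n))} {D c l : ℕ}
    (hD : ¬ ∃ Y : Finset (Fin n), Y.card = 1 ∧ D + 1 ≤ (H.filter (fun A => Y ⊆ A)).card)
    (hc : ¬ ∃ Y : Finset (Fin n), Y.card = 2 ∧ c + 1 ≤ (H.filter (fun A => Y ⊆ A)).card)
    (hl : ¬ ∃ Y : Finset (Fin n), Y.card = l + 1 ∧ 2 ≤ (H.filter (fun A => Y ⊆ A)).card)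
    (x : Fin n) : goodStar x D c l (starOf H x) := by
  push Not at hD hc hl
  refine ⟨?_, ?_, ?_⟩
  · have := hD {x} (by simp)
    simp only [Finset.singleton_subset_iff] at this
    unfold starOf
    omega
  · intro y hy
    have := hc {x, y} (Finset.card_pair hy.symm)
    refine le_trans (Finset.card_le_card ?_) (Nat.lt_succ_iff.1 this)
    intro A hA
    obtain ⟨h1, h2⟩ := Finset.mem_filter.1 hA
    obtain ⟨h3, h4⟩ := Finset.mem_filter.1 h1
    refine Finset.mem_filter.2 ⟨h3, ?_⟩
    intro z hz
    rcases Finset.mem_insert.1 hz with h | h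
    · exact h ▸ h4
    · rw [Finset.mem_singleton.1 h]; exact h2
  · intro A hA A' hA' hne
    by_contra hlt
    push Not at hlt
    obtain ⟨Y, hY, hYc⟩ := Finset.exists_subset_card_eq (Nat.succ_le_of_lt hlt)
    have := hl Y hYc
    have h2 : ({A, A'} : Finset (Finset (Fin n))) ⊆ H.filter (fun A => Y ⊆ A) := by
      intro B hB
      rcases Finset.mem_insert.1 hB with h | h
      · rw [h]
        exact Finset.mem_filter.2 ⟨(Finset.mem_filter.1 hA).1, hY.trans Finset.inter_subset_left⟩
      · rw [Finset.mem_singleton.1 h]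
        exact Finset.mem_filter.2 ⟨(Finset.mem_filter.1 hA').1, hY.trans Finset.inter_subset_right⟩
    have h3 := Finset.card_le_card h2
    rw [Finset.card_pair hne] at h3
    omega

lemma geom_tail {r : ℝ} (h0 : 0 ≤ r) (h1 : r ≤ 1 / 2) (L N : ℕ) :
    ∑ m ∈ Finset.Icc L N, r ^ m ≤ 2 * r ^ L := by
  have h : ∀ N, ∑ m ∈ Finset.range N, r ^ m ≤ 2 := by
    intro N
    induction N with
    | zero => simp
    | succ N ih =>
      rw [Finset.sum_range_succ', pow_zero]
      simp only [pow_succ]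
      rw [← Finset.sum_mul]
      have : 0 ≤ ∑ m ∈ Finset.range N, r ^ m := Finset.sum_nonneg fun _ _ => by positivity
      nlinarith
  rw [← Finset.Ico_add_one_right_eq_Icc, Finset.sum_Ico_eq_sum_range]
  simp only [pow_add]
  rw [← Finset.mul_sum, mul_comm]
  exact mul_le_mul_of_nonneg_right (h _) (by positivity)

/-- The finite-`n` bound for the probability of the forbidden configuration. -/
lemma main_bound {n k : ℕ} (hk1 : 1 ≤ k) (hk : k ≤ n) {p : ℝ} (h0 : 0 ≤ p) (h1 : p ≤ 1)
    (D c l L a : ℕ) (τ e : ℝ) (hL : e ≤ L) (hL' : (L : ℝ) < e + 1)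
    (hq0 : 0 < interProb n k) (hq1 : interProb n k ≤ 1)
    (hsmall : (D : ℝ) ^ 2 * l * ((k : ℝ) / n * (interProb n k ^ c)⁻¹) ≤ 1)
    (ρ₁ ρ₂ : ℝ)
    (hρ₁ : ((D : ℝ) + 1) * (3 * mubar n k p * interProb n k ^ ⌈τ⌉₊) ≤ ρ₁) (hρ₁' : ρ₁ ≤ 1 / 2)
    (hρ₂ : ((D : ℝ) + 1) * (3 * mubar n k p * interProb n k ^ (a - L)) ≤ ρ₂) (hρ₂' : ρ₂ ≤ 1) :
    PP p (kSets n k) (fun H => ∃ C ⊆ H, ∃ x : Fin n, IsClique C ∧ IsNontrivial C ∧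
        vdeg H x ≤ C.card ∧ τ ≤ (vdeg C x : ℝ) ∧
        (a ≤ C.card ∨ e ≤ ((C \ starOf C x).card : ℝ)))
      ≤ (n.choose 1 : ℝ) * ((mubar n k p * ((k : ℝ) / n) ^ 1) ^ (D + 1) / ((D + 1).factorial : ℝ))
        + (n.choose 2 : ℝ) * ((mubar n k p * ((k : ℝ) / n) ^ 2) ^ (c + 1) / ((c + 1).factorial : ℝ))
        + (n.choose (l + 1) : ℝ) *
          ((mubar n k p * ((k : ℝ) / n) ^ (l + 1)) ^ 2 / ((2 : ℕ).factorial : ℝ))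
        + n * (2 * ρ₁ ^ L)
        + n * (binomProbGe ((n - 1).choose (k - 1)) p (a - L) * (L * ρ₂)) := by
  classical
  have hμ := mubar_eq hk1 hk p
  have hμ0 : 0 ≤ mubar n k p := by rw [hμ]; positivity
  rw [hμ] at hμ0 hρ₁ hρ₂ ⊢
  set E1 : Finset (Finset (Fin n)) → Prop := fun H =>
    ∃ Y : Finset (Fin n), Y.card = 1 ∧ D + 1 ≤ (H.filter (fun A => Y ⊆ A)).card
  set E2 : Finset (Finset (Fin n)) → Prop := fun H =>
    ∃ Y : Finset (Fin n), Y.card = 2 ∧ c + 1 ≤ (H.filter (fun A => Y ⊆ A)).card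
  set E3 : Finset (Finset (Fin n)) → Prop := fun H =>
    ∃ Y : Finset (Fin n), Y.card = l + 1 ∧ 2 ≤ (H.filter (fun A => Y ⊆ A)).card
  set E4 : Finset (Finset (Fin n)) → Prop := fun H =>
    ∃ P ∈ (Finset.univ : Finset (Fin n)) ×ˢ Finset.Icc L (n.choose k),
      badAt P.1 D c l ⌈τ⌉₊ P.2 H
  set E5 : Finset (Finset (Fin n)) → Prop := fun H =>
    ∃ P ∈ (Finset.univ : Finset (Fin n)) ×ˢ Finset.Icc 1 L,
      badAt P.1 D c l (a - L) P.2 H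
  have b1 := PP_codeg_le hk h0 h1 1 (D + 1)
  have b2 := PP_codeg_le hk h0 h1 2 (c + 1)
  have b3 := PP_codeg_le hk h0 h1 (l + 1) 2
  have hρ₁0 : 0 ≤ ρ₁ := le_trans (by positivity) hρ₁
  have hρ₂0 : 0 ≤ ρ₂ := le_trans (by positivity) hρ₂
  have b4 : PP p (kSets n k) E4 ≤ n * (2 * ρ₁ ^ L) := by
    refine (PP_le_sum h0 h1 ((Finset.univ : Finset (Fin n)) ×ˢ Finset.Icc L (n.choose k))
      (Q := fun P H => badAt P.1 D c l ⌈τ⌉₊ P.2 H) (fun H _ h => h)).trans ?_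
    have : ∀ P ∈ (Finset.univ : Finset (Fin n)) ×ˢ Finset.Icc L (n.choose k),
        PP p (kSets n k) (fun H => badAt P.1 D c l ⌈τ⌉₊ P.2 H) ≤ ρ₁ ^ P.2 := by
      intro P _
      refine (PP_badAt_le hk1 hk h0 h1 P.1 D c l ⌈τ⌉₊ P.2 hq0 hq1 hsmall).trans ?_
      rw [← one_mul (ρ₁ ^ P.2)]
      apply mul_le_mul (binomProbGe_le_one h0 h1 _) _ (by positivity) (by norm_num)
      exact pow_le_pow_left₀ (by positivity) hρ₁ _
    refine (Finset.sum_le_sum this).trans ?_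
    rw [Finset.sum_product]
    simp only [Finset.sum_const, Finset.card_univ, Fintype.card_fin, nsmul_eq_mul]
    exact mul_le_mul_of_nonneg_left (geom_tail hρ₁0 hρ₁' _ _) (Nat.cast_nonneg _)
  have b5 : PP p (kSets n k) E5
      ≤ n * (binomProbGe ((n - 1).choose (k - 1)) p (a - L) * (L * ρ₂)) := by
    refine (PP_le_sum h0 h1 ((Finset.univ : Finset (Fin n)) ×ˢ Finset.Icc 1 L)
      (Q := fun P H => badAt P.1 D c l (a - L) P.2 H) (fun H _ h => h)).trans ?_
    have hB := binomProbGe_nonneg h0 h1 (M := (n - 1).choose (k - 1)) (a - L)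
    have : ∀ P ∈ (Finset.univ : Finset (Fin n)) ×ˢ Finset.Icc 1 L,
        PP p (kSets n k) (fun H => badAt P.1 D c l (a - L) P.2 H)
          ≤ binomProbGe ((n - 1).choose (k - 1)) p (a - L) * ρ₂ := by
      intro P hP
      have hP1 := (Finset.mem_Icc.1 (Finset.mem_product.1 hP).2).1
      refine (PP_badAt_le hk1 hk h0 h1 P.1 D c l (a - L) P.2 hq0 hq1 hsmall).trans ?_
      apply mul_le_mul_of_nonneg_left _ hB
      calc _ ≤ ρ₂ ^ P.2 := pow_le_pow_left₀ (by positivity) hρ₂ _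
        _ ≤ ρ₂ ^ 1 := pow_le_pow_of_le_one hρ₂0 hρ₂' hP1
        _ = ρ₂ := pow_one _
    refine (Finset.sum_le_sum this).trans ?_
    rw [Finset.sum_const, Finset.card_product, Finset.card_univ, Fintype.card_fin,
      Nat.card_Icc, nsmul_eq_mul, Nat.add_sub_cancel]
    push_cast
    apply le_of_eq; ring
  have hor1 := PP_or_le h0 h1 (K := kSets n k) (Q := E1) (R := E2) (P := fun H => E1 H ∨ E2 H)
    (fun _ _ h => h)
  have hor2 := PP_or_le h0 h1 (K := kSets n k) (Q := fun H => E1 H ∨ E2 H) (R := E3)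
    (P := fun H => (E1 H ∨ E2 H) ∨ E3 H) (fun _ _ h => h)
  have hor3 := PP_or_le h0 h1 (K := kSets n k) (Q := fun H => (E1 H ∨ E2 H) ∨ E3 H) (R := E4)
    (P := fun H => ((E1 H ∨ E2 H) ∨ E3 H) ∨ E4 H) (fun _ _ h => h)
  have hfin := PP_or_le h0 h1 (K := kSets n k) (Q := fun H => ((E1 H ∨ E2 H) ∨ E3 H) ∨ E4 H)
    (R := E5) (P := fun H => ∃ C ⊆ H, ∃ x : Fin n, IsClique C ∧ IsNontrivial C ∧
        vdeg H x ≤ C.card ∧ τ ≤ (vdeg C x : ℝ) ∧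
        (a ≤ C.card ∨ e ≤ ((C \ starOf C x).card : ℝ))) (by
      rintro H hH ⟨C, hCH, x, hcl, hnt, hdeg, hτ, hor⟩
      by_cases hE1 : E1 H
      · exact Or.inl (Or.inl (Or.inl (Or.inl hE1)))
      by_cases hE2 : E2 H
      · exact Or.inl (Or.inl (Or.inl (Or.inr hE2)))
      by_cases hE3 : E3 H
      · exact Or.inl (Or.inl (Or.inr hE3))
      have hgood := goodStar_of (k := k) hE1 hE2 hE3 x
      set m := (C \ starOf C x).card with hm
      have hsub : starOf C x ⊆ C := Finset.filter_subset _ _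
      have hcard : m + (starOf C x).card = C.card := Finset.card_sdiff_add_card_eq_card hsub
      have hsub' : starOf C x ⊆ starOf H x := Finset.filter_subset_filter _ hCH
      have hmiss : (starOf H x \ starOf C x).card ≤ m := by
        have := Finset.card_sdiff_add_card_eq_card hsub'
        unfold vdeg at hdeg
        omega
      have hm1 : 1 ≤ m := by
        by_contra hm0
        have hm0' : (C \ starOf C x) = ∅ := Finset.card_eq_zero.1 (by omega)
        apply hnt
        refine ⟨x, fun A hA => ?_⟩
        have := (Finset.sdiff_eq_empty_iff_subset.1 hm0') hA
        exact (Finset.mem_filter.1 this).2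
      have hbad : ∀ t, t ≤ (starOf C x).card → badAt x D c l t m H := by
        intro t ht
        refine ⟨hgood, starOf C x, hsub', ht, hmiss, C \ starOf C x,
          Finset.sdiff_subset.trans hCH, rfl, ?_⟩
        intro B hB
        obtain ⟨hBC, hBs⟩ := Finset.mem_sdiff.1 hB
        refine ⟨fun hx => hBs (Finset.mem_filter.2 ⟨hBC, hx⟩), fun A hA => ?_⟩
        exact hcl B hBC A (hsub hA)
      by_cases hme : e ≤ (m : ℝ)
      · refine Or.inl (Or.inr ⟨(x, m), ?_, hbad _ (Nat.ceil_le.2 hτ)⟩)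
        refine Finset.mem_product.2 ⟨Finset.mem_univ _, Finset.mem_Icc.2 ⟨?_, ?_⟩⟩
        · have : (L : ℝ) < m + 1 := by linarith
          have : L < m + 1 := by exact_mod_cast this
          exact Nat.lt_succ_iff.1 this
        · have h5 := Finset.card_le_card (hCH.trans hH)
          rw [kSets_card] at h5
          change m ≤ _
          omega
      · have ha : a ≤ C.card := hor.resolve_right hme
        have hmL : m ≤ L := by
          have : (m : ℝ) ≤ L := by linarith
          exact_mod_cast this
        refine Or.inr ⟨(x, m), ?_, hbad _ (by omega)⟩
        exact Finset.mem_product.2 ⟨Finset.mem_univ _, Finset.mem_Icc.2 ⟨hm1, hmL⟩⟩)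
  have hgoal := hfin.trans (add_le_add (hor3.trans (add_le_add (hor2.trans (add_le_add
    (hor1.trans (add_le_add b1 b2)) b3)) b4)) b5)
  exact hgoal

end PartFive

lemma pow_div_fact_le {x : ℝ} (hx : 0 ≤ x) {s : ℕ} (h : 8 * x ≤ s) :
    x ^ s / (s.factorial : ℝ) ≤ Real.exp (-(s : ℝ)) := by
  have h1 : x ^ s ≤ ((s : ℝ) / 8) ^ s := pow_le_pow_left₀ hx (by linarith) _
  have h2 : (s : ℝ) ^ s / (s.factorial : ℝ) ≤ Real.exp s :=
    Real.pow_div_factorial_le_exp _ (Nat.cast_nonneg _) _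
  have h3 : Real.exp s * Real.exp s ≤ 8 ^ s := by
    rw [← Real.exp_add, show (s : ℝ) + s = s * 2 by ring, Real.exp_nat_mul]
    apply pow_le_pow_left₀ (Real.exp_pos _).le
    have := Real.exp_one_lt_d9
    have h4 : Real.exp 2 = Real.exp 1 * Real.exp 1 := by rw [← Real.exp_add]; norm_num
    rw [h4]
    nlinarith [Real.exp_pos 1]
  have hf : (0 : ℝ) < s.factorial := by positivity
  calc x ^ s / (s.factorial : ℝ) ≤ ((s : ℝ) / 8) ^ s / (s.factorial : ℝ) := by gcongr
    _ = ((s : ℝ) ^ s / (s.factorial : ℝ)) / 8 ^ s := by rw [div_pow]; field_simp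
    _ ≤ Real.exp s / 8 ^ s := by gcongr
    _ ≤ Real.exp (-(s : ℝ)) := by
      rw [div_le_iff₀ (by positivity), Real.exp_neg, inv_mul_eq_div, le_div_iff₀ (Real.exp_pos _)]
      exact h3

lemma choose_eq_prod (n k : ℕ) :
    (n.choose k : ℝ) * (k.factorial : ℝ) = ∏ i ∈ Finset.range k, ((n - i : ℕ) : ℝ) := by
  rw [← Nat.cast_mul, mul_comm, ← Nat.descFactorial_eq_factorial_mul_choose,
    Nat.descFactorial_eq_prod_range]
  push_cast
  rfl

lemma interProb_ge {n k : ℕ} (hk : 2 * k < n) :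
    1 - Real.exp (-((k : ℝ) ^ 2 / n)) ≤ interProb n k := by
  rw [interProb_eq (by omega)]
  have hn : (0 : ℝ) < n := by exact_mod_cast (by omega : 0 < n)
  have hc : (0 : ℝ) < n.choose k := by exact_mod_cast Nat.choose_pos (by omega)
  have hf : (0 : ℝ) < k.factorial := by positivity
  suffices h : ((n - k).choose k : ℝ) / (n.choose k : ℝ) ≤ Real.exp (-((k : ℝ) ^ 2 / n)) by linarith
  rw [div_le_iff₀ hc]
  apply le_of_mul_le_mul_right _ hf
  rw [mul_assoc, choose_eq_prod, choose_eq_prod]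
  have : Real.exp (-((k : ℝ) ^ 2 / n)) = ∏ i ∈ Finset.range k, Real.exp (-((k : ℝ) / n)) := by
    rw [Finset.prod_const, Finset.card_range, ← Real.exp_nat_mul]
    congr 1; ring
  rw [this, ← Finset.prod_mul_distrib]
  apply Finset.prod_le_prod
  · intro i _; positivity
  · intro i hi
    have hi := Finset.mem_range.1 hi
    have h1 : ((n - k - i : ℕ) : ℝ) = n - k - i := by
      rw [Nat.cast_sub (by omega), Nat.cast_sub (by omega)]
    have h2 : ((n - i : ℕ) : ℝ) = n - i := by rw [Nat.cast_sub (by omega)]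
    rw [h1, h2]
    have h3 := Real.add_one_le_exp (-((k : ℝ) / n))
    have hni : (0 : ℝ) ≤ n - i := by rw [← h2]; positivity
    refine le_trans ?_ (mul_le_mul_of_nonneg_right h3 hni)
    have : (-((k : ℝ) / n) + 1) * (n - i) = n - k - i + k * i / n := by field_simp; ring
    rw [this]
    have : 0 ≤ (k : ℝ) * i / n := by positivity
    linarith

lemma interProb_le {n k : ℕ} (hk : 2 * k < n) :
    Real.exp (-((k : ℝ) ^ 2 / (n - 2 * k))) ≤ 1 - interProb n k := by
  rw [interProb_eq (by omega)]
  have hn : (0 : ℝ) < n - 2 * k := by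
    have : (2 : ℝ) * k < n := by exact_mod_cast hk
    linarith
  have hc : (0 : ℝ) < n.choose k := by exact_mod_cast Nat.choose_pos (by omega)
  have hf : (0 : ℝ) < k.factorial := by positivity
  suffices h : Real.exp (-((k : ℝ) ^ 2 / (n - 2 * k))) ≤ ((n - k).choose k : ℝ) / (n.choose k : ℝ) by
    linarith
  rw [le_div_iff₀ hc, Real.exp_neg, inv_mul_eq_div, div_le_iff₀ (Real.exp_pos _)]
  apply le_of_mul_le_mul_right _ hf
  rw [mul_right_comm, choose_eq_prod, choose_eq_prod]
  have : Real.exp ((k : ℝ) ^ 2 / (n - 2 * k))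
      = ∏ i ∈ Finset.range k, Real.exp ((k : ℝ) / (n - 2 * k)) := by
    rw [Finset.prod_const, Finset.card_range, ← Real.exp_nat_mul]
    congr 1; ring
  rw [this, ← Finset.prod_mul_distrib]
  apply Finset.prod_le_prod
  · intro i _; positivity
  · intro i hi
    have hi := Finset.mem_range.1 hi
    have h1 : ((n - k - i : ℕ) : ℝ) = n - k - i := by
      rw [Nat.cast_sub (by omega), Nat.cast_sub (by omega)]
    have h2 : ((n - i : ℕ) : ℝ) = n - i := by rw [Nat.cast_sub (by omega)]
    rw [h1, h2]
    have h3 := Real.add_one_le_exp ((k : ℝ) / (n - 2 * k))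
    have hik : (i : ℝ) ≤ k := by exact_mod_cast hi.le
    have hni : (0 : ℝ) ≤ n - k - i := by linarith
    refine le_trans ?_ (mul_le_mul_of_nonneg_left h3 hni)
    have h4 : (k : ℝ) / (n - 2 * k) * (n - 2 * k) = k := div_mul_cancel₀ _ hn.ne'
    have h5 : (0 : ℝ) ≤ (k : ℝ) / (n - 2 * k) := by positivity
    nlinarith

lemma interProb_ge' {n k : ℕ} (hk : 2 * k < n) {z : ℝ} (hz : z = (k : ℝ) ^ 2 / n) :
    z ≤ interProb n k * (1 + z) := by
  have h := interProb_ge hk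
  rw [← hz] at h
  have hz0 : 0 ≤ z := by rw [hz]; positivity
  have h2 := Real.add_one_le_exp z
  have h3 : Real.exp (-z) * Real.exp z = 1 := by rw [← Real.exp_add]; simp
  have h4 := Real.exp_pos (-z)
  nlinarith

lemma gchoose_ge {x : ℝ} {t : ℕ} (h1 : 1 ≤ t) (h : (t : ℝ) ≤ x) : (x / t) ^ t ≤ gchoose x t := by
  unfold gchoose
  have ht : (0 : ℝ) < t := by exact_mod_cast h1
  have hf : (0 : ℝ) < t.factorial := by positivity
  rw [le_div_iff₀ hf]
  have := choose_eq_prod t t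
  rw [Nat.choose_self, Nat.cast_one, one_mul] at this
  rw [this]
  have h2 : (x / t) ^ t = ∏ _i ∈ Finset.range t, (x / t) := by
    rw [Finset.prod_const, Finset.card_range]
  rw [h2, ← Finset.prod_mul_distrib]
  apply Finset.prod_le_prod
  · intro i _
    have : 0 ≤ x := ht.le.trans h
    positivity
  · intro i hi
    have hi := Finset.mem_range.1 hi
    rw [Nat.cast_sub hi.le]
    have h3 : x / t * t = x := by field_simp
    have h4 : 1 ≤ x / t := by rw [le_div_iff₀ ht]; linarith
    have h5 : (0 : ℝ) ≤ i := Nat.cast_nonneg _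
    nlinarith

lemma lam_le_one {n k : ℕ} {p : ℝ} {t : ℕ} (hq : 0 ≤ interProb n k) (h1 : 1 ≤ t)
    (h : (t : ℝ) ≤ mubar n k p) (hL : Lam n k p t ≤ 1) :
    (mubar n k p / t) ^ 2 * interProb n k ^ (t - 1) ≤ 1 := by
  unfold Lam at hL
  have h2 := gchoose_ge h1 h
  have h3 : (mubar n k p / t) ^ t * interProb n k ^ t.choose 2 ≤ 1 :=
    le_trans (mul_le_mul_of_nonneg_right h2 (by positivity)) hL
  have hm : 0 ≤ mubar n k p / t := by
    have : 0 ≤ mubar n k p := le_trans (Nat.cast_nonneg _) h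
    positivity
  have h4 : ((mubar n k p / t) ^ 2 * interProb n k ^ (t - 1)) ^ t ≤ 1 := by
    have : ((mubar n k p / t) ^ 2 * interProb n k ^ (t - 1)) ^ t
        = ((mubar n k p / t) ^ t * interProb n k ^ t.choose 2) ^ 2 := by
      rw [mul_pow, mul_pow, ← pow_mul, ← pow_mul, ← pow_mul, ← pow_mul, mul_comm 2 t,
        Nat.choose_two_right, Nat.div_mul_cancel (Nat.even_mul_pred_self t).two_dvd, mul_comm t (t-1)]
    rw [this]
    exact pow_le_one₀ (by positivity) h3
  by_contra hcon
  push Not at hcon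
  exact absurd h4 (not_le.2 (one_lt_pow₀ hcon (by omega)))

lemma vdeg_eq_filter {n : ℕ} (H : Finset (Finset (Fin n))) (x : Fin n) :
    vdeg H x = (H.filter (fun A => ({x} : Finset (Fin n)) ⊆ A)).card := by
  unfold vdeg starOf
  simp only [Finset.singleton_subset_iff]

/-- If the expected number of vertices of degree at least `s` is small, some `t < s` has
`Λ(t) ≤ σ`. -/
lemma principle {n k : ℕ} {p σ υ : ℝ} (hk1 : 1 ≤ k) (hk : k ≤ n) (h0 : 0 ≤ p) (h1 : p ≤ 1)
    (hL : hprob n k p (fun H => σ < Lam n k p (maxDegree H)) < υ) (hυ : υ ≤ 1 / 2) {s : ℕ}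
    (hs1 : 1 ≤ s)
    (hs : n * (phi n k p ^ s / (s.factorial : ℝ)) ≤ 1 / 2) : ∃ t < s, Lam n k p t ≤ σ := by
  rw [hprob_eq_PP] at hL
  have hn : (0 : ℝ) < n := by exact_mod_cast (by omega : 0 < n)
  have hk0 : (0 : ℝ) < k := by exact_mod_cast hk1
  have hc := PP_codeg_le hk h0 h1 1 s
  rw [← mubar_eq hk1 hk p] at hc
  have he : mubar n k p * ((k : ℝ) / n) ^ 1 = phi n k p := by
    unfold mubar; field_simp
  rw [he, Nat.choose_one_right] at hc
  have hlt : PP p (kSets n k) (fun H => σ < Lam n k p (maxDegree H)) + PP p (kSets n k)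
      (fun H => ∃ Y : Finset (Fin n), Y.card = 1 ∧ s ≤ (H.filter (fun A => Y ⊆ A)).card) < 1 := by
    linarith
  obtain ⟨H, hH, hA, hB⟩ := PP_exists h0 h1 hlt
  refine ⟨maxDegree H, ?_, not_lt.1 hA⟩
  unfold maxDegree
  rw [Finset.sup_lt_iff (by rw [Nat.bot_eq_zero]; omega)]
  intro x _
  by_contra hcon
  apply hB
  refine ⟨{x}, by simp, ?_⟩
  rw [← vdeg_eq_filter]
  omega
  
lemma PP_empty_ge {n k : ℕ} {p σ υ : ℝ} (h0 : 0 ≤ p) (h1 : p ≤ 1)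
    (hL : hprob n k p (fun H => σ < Lam n k p (maxDegree H)) < υ) (hσ : σ < 1) :
    (1 - p) ^ (n.choose k) < υ := by
  refine lt_of_le_of_lt ?_ hL
  unfold hprob
  classical
  have hL0 : Lam n k p (maxDegree (∅ : Finset (Finset (Fin n)))) = 1 := by
    have : maxDegree (∅ : Finset (Finset (Fin n))) = 0 := by
      unfold maxDegree vdeg starOf; simp
    rw [this]; unfold Lam gchoose; simp
  refine le_trans (le_of_eq ?_) (Finset.single_le_sum (f := fun H : Finset (Finset (Fin n)) =>
    if σ < Lam n k p (maxDegree H) then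
      p ^ H.card * (1 - p) ^ ((kSets n k).card - H.card) else 0) ?_
      (Finset.empty_mem_powerset (kSets n k)))
  · simp only [hL0, hσ, if_true, Finset.card_empty, pow_zero, one_mul, Nat.sub_zero, kSets_card]
  · intro H _
    have : 0 ≤ 1 - p := by linarith
    split_ifs <;> positivity

lemma mubar_ge_ten {n k : ℕ} {p σ υ : ℝ} (hk1 : 1 ≤ k) (hk : k < n) (hn : 20 ≤ n)
    (h0 : 0 ≤ p) (h1 : p ≤ 1)
    (hL : hprob n k p (fun H => σ < Lam n k p (maxDegree H)) < υ) (hσ : σ < 1)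
    (hυ : υ ≤ Real.exp (-20)) (hN : n ≤ n.choose k) : 10 ≤ mubar n k p := by
  by_contra hcon
  push Not at hcon
  have h := PP_empty_ge h0 h1 hL hσ
  rw [mubar_eq hk1 hk.le] at hcon
  have hNr : (20 : ℝ) ≤ n.choose k := by exact_mod_cast hn.trans hN
  have hp : p < 1 / 2 := by
    by_contra hp
    push Not at hp
    nlinarith
  have h3 : Real.exp (-(2 * p)) ≤ 1 - p := by
    have h4 := Real.add_one_le_exp (2 * p)
    have h5 : Real.exp (-(2 * p)) * Real.exp (2 * p) = 1 := by rw [← Real.exp_add]; simp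
    have h6 := Real.exp_pos (-(2 * p))
    have h7 : (1 - p) * (2 * p + 1) ≥ 1 := by nlinarith
    have h8 : (1 - p) * Real.exp (2 * p) ≥ 1 := by nlinarith
    have h9 := Real.exp_pos (2 * p)
    by_contra hc
    push Not at hc
    nlinarith
  have h4 : Real.exp (-20) ≤ (1 - p) ^ (n.choose k) := by
    calc Real.exp (-20) ≤ Real.exp ((n.choose k : ℕ) * (-(2 * p))) := by
          apply Real.exp_le_exp.2; nlinarith
      _ = Real.exp (-(2 * p)) ^ (n.choose k) := Real.exp_nat_mul _ _
      _ ≤ _ := pow_le_pow_left₀ (Real.exp_pos _).le h3 _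
  linarith

lemma le_choose_self {n k : ℕ} (hk1 : 1 ≤ k) (hk : k < n) : n ≤ n.choose k := by
  induction n generalizing k with
  | zero => omega
  | succ n ih =>
    obtain ⟨j, rfl⟩ : ∃ j, k = j + 1 := ⟨k - 1, by omega⟩
    rw [Nat.choose_succ_succ, Nat.succ_eq_add_one]
    rcases Nat.lt_or_ge (j + 1) n with h | h
    · have := ih (k := j + 1) (by omega) h
      have : 0 < n.choose j := Nat.choose_pos (by omega)
      omega
    · have : n = j + 1 := by omega
      subst this
      rw [Nat.choose_self, Nat.choose_succ_self_right]

lemma phi_nonneg {n k : ℕ} {p : ℝ} (h0 : 0 ≤ p) : 0 ≤ phi n k p := by unfold phi; positivity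

lemma phi_eq_mubar {n k : ℕ} {p : ℝ} (hk1 : 1 ≤ k) (hk : k ≤ n) :
    phi n k p = mubar n k p * k / n := by
  have hn : (0 : ℝ) < n := by exact_mod_cast (by omega : 0 < n)
  have hk0 : (0 : ℝ) < k := by exact_mod_cast hk1
  unfold mubar; field_simp

lemma phi_lower {n k : ℕ} {p σ υ θ B : ℝ} {s0 : ℕ} (hk1 : 1 ≤ k) (hk : 2 * k < n) (hn : 20 ≤ n)
    (h0 : 0 ≤ p) (h1 : p ≤ 1)
    (hL : hprob n k p (fun H => σ < Lam n k p (maxDegree H)) < υ) (hσ : σ ≤ 1 / 16)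
    (hυ : υ ≤ Real.exp (-20)) (hq0 : 0 < interProb n k) (hq1 : interProb n k ≤ 1)
    (hs0 : 1 ≤ s0)
    (hθ : n * θ ^ s0 ≤ 1 / 2) (hB0 : 0 ≤ B)
    (hB : (s0 : ℝ) ^ 2 * (interProb n k ^ s0)⁻¹ ≤ B ^ 2)
    (h3 : n * (B * k / n) ^ 3 ≤ 1 / 2) : θ ≤ phi n k p := by
  by_contra hcon
  push Not at hcon
  have hφ0 : 0 ≤ phi n k p := phi_nonneg h0
  have hn0 : (0 : ℝ) < n := by exact_mod_cast (by omega : 0 < n)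
  have hk0 : (0 : ℝ) < k := by exact_mod_cast hk1
  have hm10 : 10 ≤ mubar n k p := mubar_ge_ten hk1 (by omega) hn h0 h1 hL (by linarith) hυ
    (le_choose_self hk1 (by omega))
  have hυ2 : υ ≤ 1 / 2 := by
    refine hυ.trans ?_
    have h5 : Real.exp (-20) * Real.exp 20 = 1 := by rw [← Real.exp_add]; simp
    have h6 := Real.add_one_le_exp (20 : ℝ)
    nlinarith [Real.exp_pos (-20)]
  have hdiv : ∀ s : ℕ, n * (phi n k p ^ s / (s.factorial : ℝ)) ≤ n * phi n k p ^ s := by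
    intro s
    apply mul_le_mul_of_nonneg_left _ hn0.le
    apply div_le_self (by positivity)
    exact_mod_cast Nat.factorial_pos s
  have hlam0 : ¬ Lam n k p 0 ≤ σ := by unfold Lam gchoose; simp; linarith
  have hlam1 : ¬ Lam n k p 1 ≤ σ := by unfold Lam gchoose; simp; linarith
  obtain ⟨t, ht, hLt⟩ := principle hk1 (by omega) h0 h1 hL hυ2 hs0
    ((hdiv s0).trans (le_trans (mul_le_mul_of_nonneg_left
      (pow_le_pow_left₀ hφ0 hcon.le _) hn0.le) hθ))
  have ht1 : 1 ≤ t := by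
    rcases Nat.eq_zero_or_pos t with h | h
    · subst h; exact absurd hLt hlam0
    · exact h
  have hmB : mubar n k p ≤ B := by
    have hts : (t : ℝ) ≤ s0 := by exact_mod_cast ht.le
    have hinv : 1 ≤ (interProb n k ^ s0)⁻¹ := (one_le_inv₀ (by positivity)).2 (pow_le_one₀ hq0.le hq1)
    rcases lt_or_ge (mubar n k p) t with h | h
    · refine (sq_le_sq₀ (by linarith) hB0).1 ?_
      have : mubar n k p ^ 2 ≤ (s0 : ℝ) ^ 2 := pow_le_pow_left₀ (by linarith) (by linarith) _
      nlinarith [sq_nonneg (s0 : ℝ)]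
    · have h4 := lam_le_one hq0.le ht1 h (hLt.trans (by linarith))
      refine (sq_le_sq₀ (by linarith) hB0).1 ?_
      refine le_trans ?_ hB
      have htp : (0 : ℝ) < t := by exact_mod_cast ht1
      have hqq : interProb n k ^ s0 ≤ interProb n k ^ (t - 1) :=
        pow_le_pow_of_le_one hq0.le hq1 (by omega)
      rw [← div_eq_mul_inv, le_div_iff₀ (by positivity)]
      have h5 : mubar n k p ^ 2 = (mubar n k p / t) ^ 2 * (t : ℝ) ^ 2 := by field_simp
      have h6 : (mubar n k p / t) ^ 2 * interProb n k ^ s0 ≤ 1 :=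
        le_trans (mul_le_mul_of_nonneg_left hqq (by positivity)) h4
      calc mubar n k p ^ 2 * interProb n k ^ s0
          = ((mubar n k p / t) ^ 2 * interProb n k ^ s0) * (t : ℝ) ^ 2 := by rw [h5]; ring
        _ ≤ 1 * (t : ℝ) ^ 2 := by gcongr
        _ ≤ (s0 : ℝ) ^ 2 := by rw [one_mul]; gcongr
  have hφm := phi_eq_mubar (p := p) hk1 (by omega : k ≤ n)
  obtain ⟨t, ht, hLt⟩ := principle (s := 3) hk1 (by omega) h0 h1 hL hυ2 (by norm_num)
    ((hdiv 3).trans (le_trans (mul_le_mul_of_nonneg_left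
      (pow_le_pow_left₀ hφ0 (by rw [hφm]; gcongr) _) hn0.le) h3))
  interval_cases t
  · exact hlam0 hLt
  · exact hlam1 hLt
  have hz := interProb_ge' hk (z := (k : ℝ) ^ 2 / n) rfl
  set z := (k : ℝ) ^ 2 / n with hzdef
  have hL2 : mubar n k p * (mubar n k p - 1) / 2 * interProb n k ≤ σ := by
    have : Lam n k p 2 = mubar n k p * (mubar n k p - 1) / 2 * interProb n k := by
      unfold Lam gchoose; simp [Finset.prod_range_succ]
    rwa [← this]
  have hz0 : 0 ≤ z := by positivity
  have hmq : mubar n k p ^ 2 * interProb n k ≤ 4 * σ := by nlinarith [mul_pos (by linarith : 0 < mubar n k p) hq0]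
  have hq2 : interProb n k ≤ 1 / 2 := by nlinarith
  have hz2 : z ≤ 2 * interProb n k := by nlinarith
  have hnφ : n * phi n k p ^ 2 = mubar n k p ^ 2 * z := by rw [hφm, hzdef]; field_simp
  have hb : n * phi n k p ^ 2 ≤ 8 * σ := by
    rw [hnφ]; nlinarith [sq_nonneg (mubar n k p)]
  obtain ⟨t, ht, hLt⟩ := principle (s := 2) hk1 (by omega) h0 h1 hL hυ2 (by norm_num)
    ((hdiv 2).trans (by linarith))
  interval_cases t
  · exact hlam0 hLt
  · exact hlam1 hLt

/-- Facts valid for all large `n`. -/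
structure Good (ε η : ℝ) (n k : ℕ) (p σ υ : ℝ) : Prop where
  hε0 : 0 < ε
  hε1 : ε < 1 / 4
  hη : η = ε ^ 2 / 100
  hp0 : 0 ≤ p
  hp1 : p ≤ 1
  hk2 : 2 ≤ k
  hkn : 2 * k < n
  hq : (n : ℝ) ^ (-η) ≤ interProb n k
  hq' : (n : ℝ) ^ (-(1 / 4 - ε + η)) ≤ 1 - interProb n k
  hkl : (n : ℝ) ^ (1 / 2 - η) ≤ k
  hku : (k : ℝ) ≤ (n : ℝ) ^ (1 / 2 + η)
  hz : (k : ℝ) ^ 2 / n ≤ Real.log n / 4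
  hφ0 : (n : ℝ) ^ (-η) ≤ phi n k p
  hφ : phi n k p ≤ phiStar n k
  hlog : 8 * Real.log n + 10 ≤ (n : ℝ) ^ η
  hlog3 : Real.log n ^ 3 ≤ (n : ℝ) ^ η
  hlog4 : 4 ≤ Real.log n
  hεn : 2 / ε + 1 ≤ (n : ℝ) ^ η
  hL : hprob n k p (fun H => σ < Lam n k p (maxDegree H)) < υ
  hσ : σ < 1
  hυ : υ ≤ 1 / 2

namespace Good
variable {ε η : ℝ} {n k : ℕ} {p σ υ : ℝ}

lemma n1 (h : Good ε η n k p σ υ) : (1 : ℝ) ≤ n := by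
  have := h.hkn
  exact_mod_cast (by omega : 1 ≤ n)

lemma npos (h : Good ε η n k p σ υ) : (0 : ℝ) < n := lt_of_lt_of_le one_pos h.n1

lemma kpos (h : Good ε η n k p σ υ) : (0 : ℝ) < k := by
  have := h.hk2
  exact_mod_cast (by omega : 0 < k)

lemma η0 (h : Good ε η n k p σ υ) : 0 < η := by rw [h.hη]; have := h.hε0; positivity

lemma ηle (h : Good ε η n k p σ υ) : 400 * η ≤ ε := by
  rw [h.hη]; nlinarith [h.hε0, h.hε1]

lemma r_mul (h : Good ε η n k p σ υ) (a b : ℝ) : (n : ℝ) ^ a * (n : ℝ) ^ b = (n : ℝ) ^ (a + b) :=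
  (Real.rpow_add h.npos a b).symm

lemma r_mono (h : Good ε η n k p σ υ) {a b : ℝ} (hab : a ≤ b) : (n : ℝ) ^ a ≤ (n : ℝ) ^ b :=
  Real.rpow_le_rpow_of_exponent_le h.n1 hab

lemma r_pos (h : Good ε η n k p σ υ) (a : ℝ) : 0 < (n : ℝ) ^ a := Real.rpow_pos_of_pos h.npos a

lemma r_pow (h : Good ε η n k p σ υ) (a : ℝ) (m : ℕ) : ((n : ℝ) ^ a) ^ m = (n : ℝ) ^ (a * m) := by
  rw [Real.rpow_mul h.npos.le, Real.rpow_natCast]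

lemma r_exp (h : Good ε η n k p σ υ) (a : ℝ) : Real.exp (a * Real.log n) = (n : ℝ) ^ a := by
  rw [Real.rpow_def_of_pos h.npos, mul_comm]

lemma q0 (h : Good ε η n k p σ υ) : 0 < interProb n k := lt_of_lt_of_le (h.r_pos _) h.hq

lemma q1 (h : Good ε η n k p σ υ) : interProb n k < 1 := by
  have := h.r_pos (-(1 / 4 - ε + η)); linarith [h.hq']

lemma logq (h : Good ε η n k p σ υ) :
    (n : ℝ) ^ (-(1 / 4 - ε + η)) ≤ Real.log (1 / interProb n k) := by
  refine h.hq'.trans ?_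
  rw [one_div, Real.log_inv]
  have := Real.log_le_sub_one_of_pos h.q0
  linarith

lemma phi_le (h : Good ε η n k p σ υ) : phi n k p ≤ (n : ℝ) ^ (1 / 4 - ε + 2 * η) := by
  refine h.hφ.trans ?_
  unfold phiStar
  rw [div_le_iff₀ (lt_of_lt_of_le (h.r_pos _) h.logq)]
  calc Real.log n ^ 3 ≤ (n : ℝ) ^ η := h.hlog3
    _ = (n : ℝ) ^ (1 / 4 - ε + 2 * η) * (n : ℝ) ^ (-(1 / 4 - ε + η)) := by
      rw [h.r_mul]; congr 1; ring
    _ ≤ _ := mul_le_mul_of_nonneg_left h.logq (h.r_pos _).le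

lemma phi0 (h : Good ε η n k p σ υ) : 0 < phi n k p := lt_of_lt_of_le (h.r_pos _) h.hφ0

end Good

/-- The degree bound. -/
noncomputable def DD (n k : ℕ) (p : ℝ) : ℕ := ⌈8 * max (phi n k p) (Real.log n)⌉₊

namespace Good
variable {ε η : ℝ} {n k : ℕ} {p σ υ : ℝ}

lemma D_ge (_h : Good ε η n k p σ υ) : 8 * phi n k p ≤ DD n k p ∧ 8 * Real.log n ≤ DD n k p := by
  have := Nat.le_ceil (8 * max (phi n k p) (Real.log n))
  have h1 := le_max_left (phi n k p) (Real.log n)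
  have h2 := le_max_right (phi n k p) (Real.log n)
  unfold DD
  constructor <;> linarith

lemma D_lt (h : Good ε η n k p σ υ) :
    (DD n k p : ℝ) + 1 ≤ 8 * phi n k p + 8 * Real.log n + 2 := by
  have h0 : 0 ≤ 8 * max (phi n k p) (Real.log n) := by
    have := le_max_left (phi n k p) (Real.log n); linarith [h.phi0]
  have := Nat.ceil_lt_add_one h0
  have h1 : max (phi n k p) (Real.log n) ≤ phi n k p + Real.log n :=
    max_le (by linarith [h.hlog4]) (by linarith [h.phi0])
  unfold DD
  linarith

lemma D_le1 (h : Good ε η n k p σ υ) : (DD n k p : ℝ) + 1 ≤ phi n k p * (n : ℝ) ^ (2 * η) := by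
  have h1 := h.D_lt
  have h2 : 1 ≤ phi n k p * (n : ℝ) ^ η := by
    have := mul_le_mul_of_nonneg_right h.hφ0 (h.r_pos η).le
    rw [h.r_mul] at this; simpa using this
  have h3 : (n : ℝ) ^ (2 * η) = (n : ℝ) ^ η * (n : ℝ) ^ η := by rw [h.r_mul]; congr 1; ring
  have h4 := h.hlog
  have h5 := h.phi0
  have h6 := h.hlog4
  have h7 : (1 : ℝ) ≤ (n : ℝ) ^ η := by linarith
  rw [h3, ← mul_assoc]
  have h8 : phi n k p ≤ phi n k p * (n : ℝ) ^ η := le_mul_of_one_le_right h5.le h7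
  have h9 : 0 ≤ phi n k p * (n : ℝ) ^ η := by linarith
  nlinarith

lemma D_le2 (h : Good ε η n k p σ υ) : (DD n k p : ℝ) + 1 ≤ (n : ℝ) ^ (1 / 4 - ε + 3 * η) := by
  have h1 := h.D_lt
  have h2 := h.phi_le
  have h3 : (n : ℝ) ^ (1 / 4 - ε + 3 * η) = (n : ℝ) ^ (1 / 4 - ε + 2 * η) * (n : ℝ) ^ η := by
    rw [h.r_mul]; congr 1; ring
  have h4 : 1 ≤ (n : ℝ) ^ (1 / 4 - ε + 2 * η) :=
    Real.one_le_rpow h.n1 (by linarith [h.hε1, h.η0])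
  rw [h3]
  nlinarith [h.hlog, h.hlog4]

lemma D1 (h : Good ε η n k p σ υ) : (1 : ℝ) ≤ DD n k p := by
  linarith [h.D_ge.2, h.hlog4]

lemma tail (h : Good ε η n k p σ υ) :
    phi n k p ^ (DD n k p + 1) / ((DD n k p + 1).factorial : ℝ) ≤ (n : ℝ) ^ (-8 : ℝ) := by
  refine (pow_div_fact_le h.phi0.le ?_).trans ?_
  · push_cast; linarith [h.D_ge.1]
  · rw [← h.r_exp]
    apply Real.exp_le_exp.2
    push_cast; linarith [h.D_ge.2]

lemma nsmall (h : Good ε η n k p σ υ) {a : ℝ} (ha : a ≤ -η) : (n : ℝ) ^ a ≤ 1 / 10 := by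
  refine (h.r_mono ha).trans ?_
  have h1 : (n : ℝ) ^ η * (n : ℝ) ^ (-η) = 1 := by rw [h.r_mul]; simp
  nlinarith [h.hlog, h.hlog4, h.r_pos (-η)]

lemma r_one (h : Good ε η n k p σ υ) : (n : ℝ) ^ (1 : ℝ) = n := by
  have := h.n1
  exact Real.rpow_one _

lemma eta_small (h : Good ε η n k p σ υ) : η ≤ 1 / 1600 := by linarith [h.ηle, h.hε1]

lemma alpha2_mem (h : Good ε η n k p σ υ) :
    alpha2 n k p σ ≤ DD n k p ∧ Lam n k p (alpha2 n k p σ) ≤ σ ∧ 1 ≤ alpha2 n k p σ := by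
  have hk2 := h.hk2
  have hkn := h.hkn
  obtain ⟨t, ht, hLt⟩ := principle (s := DD n k p + 1) (by omega) (by omega) h.hp0 h.hp1 h.hL h.hυ
    (by omega) (by
      refine le_trans (mul_le_mul_of_nonneg_left h.tail h.npos.le) ?_
      nth_rewrite 1 [← h.r_one]
      rw [h.r_mul]
      have := h.nsmall (a := 1 + -8) (by linarith [h.eta_small])
      linarith)
  have hmem : Lam n k p (alpha2 n k p σ) ≤ σ :=
    Nat.sInf_mem (s := {t : ℕ | Lam n k p t ≤ σ}) ⟨t, hLt⟩
  refine ⟨?_, hmem, ?_⟩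
  · have : alpha2 n k p σ ≤ t := Nat.sInf_le (s := {t : ℕ | Lam n k p t ≤ σ}) hLt
    omega
  · rcases Nat.eq_zero_or_pos (alpha2 n k p σ) with h0 | h0
    · rw [h0] at hmem
      have : Lam n k p 0 = 1 := by unfold Lam gchoose; simp
      rw [this] at hmem
      linarith [h.hσ]
    · exact h0

lemma alpha1_le_D (h : Good ε η n k p σ υ) : alpha1 n k p ≤ DD n k p := by
  have hk2 := h.hk2
  have hkn := h.hkn
  apply alpha1_le h.hp0 h.hp1
  refine lt_of_le_of_lt h.tail ?_
  rw [lt_div_iff₀ h.npos]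
  nth_rewrite 2 [← h.r_one]
  rw [h.r_mul]
  have := h.nsmall (a := (-8 : ℝ) + 1) (by linarith [h.eta_small])
  have h4 := h.hlog4
  exact lt_of_le_of_lt this (by linarith)

lemma alphaP_le_D (h : Good ε η n k p σ υ) : alphaP n k p σ ≤ DD n k p :=
  max_le h.alpha1_le_D h.alpha2_mem.1

lemma mubar_le (h : Good ε η n k p σ υ) : mubar n k p ≤ n := by
  unfold mubar
  rw [div_le_iff₀ h.kpos]
  have : phi n k p ≤ k := h.phi_le.trans ((h.r_mono (by linarith [h.hε0, h.eta_small])).trans h.hkl)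
  nlinarith [h.npos]

lemma k_div (h : Good ε η n k p σ υ) : (k : ℝ) / n ≤ (n : ℝ) ^ (-(1 / 2) + η) := by
  rw [div_le_iff₀ h.npos]
  nth_rewrite 2 [← h.r_one]
  rw [h.r_mul]
  exact h.hku.trans (h.r_mono (by linarith))

lemma mubar_pos (h : Good ε η n k p σ υ) : 0 < mubar n k p := by
  have := h.phi0; have := h.npos; have := h.kpos
  unfold mubar; positivity

lemma D_div (h : Good ε η n k p σ υ) :
    (DD n k p : ℝ) / mubar n k p ≤ (n : ℝ) ^ (-(1 / 2) + 3 * η) := by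
  rw [div_le_iff₀ h.mubar_pos]
  have h1 := h.D_le1
  have h2 : phi n k p = mubar n k p * (k / n) := by
    rw [phi_eq_mubar (by linarith [h.hk2]) (by linarith [h.hkn])]; ring
  have h3 : (n : ℝ) ^ (-(1 / 2) + 3 * η) = (n : ℝ) ^ (-(1 / 2) + η) * (n : ℝ) ^ (2 * η) := by
    rw [h.r_mul]; congr 1; ring
  rw [h3]
  calc (DD n k p : ℝ) ≤ mubar n k p * (k / n) * (n : ℝ) ^ (2 * η) := by rw [← h2]; linarith
    _ ≤ mubar n k p * (n : ℝ) ^ (-(1 / 2) + η) * (n : ℝ) ^ (2 * η) := by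
      have := h.mubar_pos
      have := h.k_div
      gcongr
    _ = _ := by ring

/-- `q^(α₂-1) ≤ (D/μ̄)²`. -/
lemma q_alpha (h : Good ε η n k p σ υ) :
    interProb n k ^ (alpha2 n k p σ - 1) ≤ ((DD n k p : ℝ) / mubar n k p) ^ 2 := by
  obtain ⟨h1, h2, h3⟩ := h.alpha2_mem
  have hD : (alpha2 n k p σ : ℝ) ≤ DD n k p := by exact_mod_cast h1
  have hm := h.mubar_pos
  have hd : (DD n k p : ℝ) / mubar n k p ≤ 1 := by
    have := h.nsmall (a := -(1 / 2) + 3 * η) (by linarith [h.eta_small])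
    linarith [h.D_div]
  rw [div_le_one hm] at hd
  have h4 := lam_le_one h.q0.le h3 (hD.trans hd) (h2.trans h.hσ.le)
  have hap : (0 : ℝ) < alpha2 n k p σ := by exact_mod_cast h3
  have h5 : interProb n k ^ (alpha2 n k p σ - 1) ≤ ((alpha2 n k p σ : ℝ) / mubar n k p) ^ 2 := by
    rw [← inv_div, inv_pow, ← one_div, le_div_iff₀ (by positivity), mul_comm]
    exact h4
  refine h5.trans ?_
  gcongr

end Good

namespace Good
variable {ε η : ℝ} {n k : ℕ} {p σ υ : ℝ}

lemma three_DD (h : Good ε η n k p σ υ) :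
    3 * ((DD n k p : ℝ) + 1) * DD n k p ≤ (n : ℝ) ^ (1 / 2 - 2 * ε + 7 * η) := by
  have h1 := h.D_le2
  have h2 := h.D1
  have h3 : (3 : ℝ) ≤ (n : ℝ) ^ η := by linarith [h.hlog, h.hlog4]
  have h4 : (n : ℝ) ^ (1 / 2 - 2 * ε + 7 * η)
      = (n : ℝ) ^ η * (n : ℝ) ^ (1 / 4 - ε + 3 * η) * (n : ℝ) ^ (1 / 4 - ε + 3 * η) := by
    rw [h.r_mul, h.r_mul]; congr 1; ring
  rw [h4]
  have := h.r_pos η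
  have := h.r_pos (1 / 4 - ε + 3 * η)
  gcongr
  linarith

lemma rho1 (h : Good ε η n k p σ υ) :
    ((DD n k p : ℝ) + 1) * (3 * mubar n k p * interProb n k ^ ⌈tauP ε n k p σ⌉₊)
      ≤ (n : ℝ) ^ (-(3 / 4 * ε)) := by
  have hq0 := h.q0
  have hq1 := h.q1
  have hm := h.mubar_pos
  have hD1 := h.D1
  have hε0 := h.hε0
  have hε1 := h.hε1
  have hη := h.ηle
  have hη0 := h.η0
  have hstep : interProb n k ^ ⌈tauP ε n k p σ⌉₊ ≤ interProb n k ^ (tauP ε n k p σ) := by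
    rw [← Real.rpow_natCast]
    exact Real.rpow_le_rpow_of_exponent_ge hq0 hq1.le (Nat.le_ceil _)
  rcases le_total (alphaP n k p σ) ⌊phiStar n k / 3⌋₊ with hc | hc
  · have hg : gammaP n k p σ = alphaP n k p σ := min_eq_left hc
    set x := (DD n k p : ℝ) / mubar n k p with hx
    have hx0 : 0 < x := by positivity
    have h1 : interProb n k ^ (tauP ε n k p σ) ≤ x * x ^ (1 - 2 * ε) := by
      have h2 : ((alpha2 n k p σ - 1 : ℕ) : ℝ) * (1 - ε) ≤ tauP ε n k p σ := by
        unfold tauP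
        rw [hg, mul_comm]
        apply mul_le_mul_of_nonneg_left _ (by linarith)
        have : alpha2 n k p σ ≤ alphaP n k p σ := le_max_right _ _
        exact_mod_cast (by omega : alpha2 n k p σ - 1 ≤ alphaP n k p σ)
      refine (Real.rpow_le_rpow_of_exponent_ge hq0 hq1.le h2).trans ?_
      rw [Real.rpow_mul hq0.le, Real.rpow_natCast]
      refine (Real.rpow_le_rpow (by positivity) h.q_alpha (by linarith)).trans (le_of_eq ?_)
      rw [← hx, ← Real.rpow_natCast, ← Real.rpow_mul hx0.le]
      nth_rewrite 2 [← Real.rpow_one x]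
      rw [← Real.rpow_add hx0]
      congr 1; push_cast; ring
    have h3 : x ^ (1 - 2 * ε) ≤ (n : ℝ) ^ ((-(1 / 2) + 3 * η) * (1 - 2 * ε)) := by
      rw [Real.rpow_mul h.npos.le]
      exact Real.rpow_le_rpow hx0.le h.D_div (by linarith)
    have hmx : mubar n k p * x = DD n k p := by rw [hx]; field_simp
    calc ((DD n k p : ℝ) + 1) * (3 * mubar n k p * interProb n k ^ ⌈tauP ε n k p σ⌉₊)
        ≤ ((DD n k p : ℝ) + 1) * (3 * mubar n k p *
          (x * (n : ℝ) ^ ((-(1 / 2) + 3 * η) * (1 - 2 * ε)))) := by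
          gcongr
          exact hstep.trans (h1.trans (by gcongr))
      _ = 3 * ((DD n k p : ℝ) + 1) * (mubar n k p * x) *
          (n : ℝ) ^ ((-(1 / 2) + 3 * η) * (1 - 2 * ε)) := by ring
      _ ≤ (n : ℝ) ^ (1 / 2 - 2 * ε + 7 * η) * (n : ℝ) ^ ((-(1 / 2) + 3 * η) * (1 - 2 * ε)) := by
          rw [hmx]
          exact mul_le_mul_of_nonneg_right h.three_DD (h.r_pos _).le
      _ ≤ _ := by
          rw [h.r_mul]
          apply h.r_mono
          nlinarith [mul_pos hε0 hη0]
  · have hg : gammaP n k p σ = ⌊phiStar n k / 3⌋₊ := min_eq_right hc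
    have hlq : 0 < Real.log (1 / interProb n k) := lt_of_lt_of_le (h.r_pos _) h.logq
    have hlq' : Real.log (1 / interProb n k) = - Real.log (interProb n k) := by
      rw [one_div, Real.log_inv]
    have hqη : Real.log (1 / interProb n k) ≤ η * Real.log n := by
      have := Real.log_le_log (h.r_pos _) h.hq
      rw [Real.log_rpow h.npos] at this
      linarith
    have hfl : phiStar n k / 3 - 1 < gammaP n k p σ := by
      rw [hg]; exact Nat.sub_one_lt_floor _
    have hps : phiStar n k * Real.log (1 / interProb n k) = Real.log n ^ 3 := by
      unfold phiStar; field_simp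
    have hl4 := h.hlog4
    have h1 : interProb n k ^ (tauP ε n k p σ) ≤ (n : ℝ) ^ (-3 : ℝ) := by
      rw [Real.rpow_def_of_pos hq0, ← h.r_exp]
      apply Real.exp_le_exp.2
      have h2 : (1 - ε) * (phiStar n k / 3 - 1) ≤ tauP ε n k p σ := by
        unfold tauP
        exact mul_le_mul_of_nonneg_left hfl.le (by linarith)
      have h3 := mul_le_mul_of_nonneg_left h2 hlq.le
      have h4 : Real.log (1 / interProb n k) * ((1 - ε) * (phiStar n k / 3 - 1))
          = (1 - ε) * (Real.log n ^ 3 / 3 - Real.log (1 / interProb n k)) := by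
        rw [← hps]; ring
      rw [h4] at h3
      have h5 : Real.log n ^ 3 ≥ 16 * Real.log n := by nlinarith [mul_nonneg (by linarith : 0 ≤ Real.log n) (by nlinarith : 0 ≤ Real.log n ^ 2 - 16)]
      have h6 : η * Real.log n ≤ Real.log n / 1600 := by
        have := mul_le_mul_of_nonneg_right h.eta_small (by linarith : 0 ≤ Real.log n)
        linarith
      have h7 : 3 * Real.log n ≤ (1 - ε) * (Real.log n ^ 3 / 3 - Real.log (1 / interProb n k)) := by
        have h8 : 5 * Real.log n ≤ Real.log n ^ 3 / 3 - Real.log (1 / interProb n k) := by linarith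
        nlinarith
      rw [hlq'] at h3 h7
      linarith
    have h3 : ((DD n k p : ℝ) + 1) * 3 ≤ n := by
      have := h.three_DD
      have h4 : (n : ℝ) ^ (1 / 2 - 2 * ε + 7 * η) ≤ (n : ℝ) ^ (1 : ℝ) := h.r_mono (by linarith)
      rw [h.r_one] at h4
      nlinarith
    calc ((DD n k p : ℝ) + 1) * (3 * mubar n k p * interProb n k ^ ⌈tauP ε n k p σ⌉₊)
        ≤ ((DD n k p : ℝ) + 1) * (3 * n * (n : ℝ) ^ (-3 : ℝ)) := by
          have := h.mubar_le
          have := hstep.trans h1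
          gcongr
      _ = (((DD n k p : ℝ) + 1) * 3) * (n * (n : ℝ) ^ (-3 : ℝ)) := by ring
      _ ≤ n * (n * (n : ℝ) ^ (-3 : ℝ)) := by
          have := h.npos; have := h.r_pos (-3)
          gcongr
      _ = (n : ℝ) ^ (-1 : ℝ) := by
          nth_rewrite 1 [← h.r_one]
          nth_rewrite 2 [← h.r_one]
          rw [h.r_mul, h.r_mul]; norm_num
      _ ≤ _ := h.r_mono (by linarith)

lemma L_bound (h : Good ε η n k p σ υ) : 2 / ε ≤ (⌈2 / ε⌉₊ : ℝ) ∧ (⌈2 / ε⌉₊ : ℝ) < 2 / ε + 1 :=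
  ⟨Nat.le_ceil _, Nat.ceil_lt_add_one (by have := h.hε0; positivity)⟩

lemma L_eta (h : Good ε η n k p σ υ) : ((⌈2 / ε⌉₊ : ℝ) + 1) * η ≤ 3 * ε / 100 := by
  have h1 := h.L_bound.2
  have h2 : 2 / ε * ε = 2 := div_mul_cancel₀ _ h.hε0.ne'
  have h3 : ((⌈2 / ε⌉₊ : ℝ) + 1) * η ≤ (2 / ε + 2) * η :=
    mul_le_mul_of_nonneg_right (by linarith) h.η0.le
  refine h3.trans ?_
  rw [h.hη]
  have : (2 / ε + 2) * (ε ^ 2 / 100) = (2 / ε * ε * ε + 2 * ε ^ 2) / 100 := by ring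
  rw [this, h2]
  nlinarith [h.hε0, h.hε1]

lemma qinv_pow (h : Good ε η n k p σ υ) (m : ℕ) :
    (interProb n k ^ m)⁻¹ ≤ (n : ℝ) ^ (m * η) := by
  have h1 : ((n : ℝ) ^ (-η)) ^ m ≤ interProb n k ^ m := pow_le_pow_left₀ (h.r_pos _).le h.hq _
  rw [h.r_pow] at h1
  have h2 : (n : ℝ) ^ (m * η) = ((n : ℝ) ^ (-η * m))⁻¹ := by
    rw [← Real.rpow_neg h.npos.le]; congr 1; ring
  rw [h2]
  exact inv_anti₀ (h.r_pos _) h1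

lemma rho2 (h : Good ε η n k p σ υ) :
    ((DD n k p : ℝ) + 1) * (3 * mubar n k p * interProb n k ^ (alphaP n k p σ - ⌈2 / ε⌉₊))
      ≤ (n : ℝ) ^ (-ε) := by
  set L := ⌈2 / ε⌉₊ with hL
  have hq0 := h.q0
  have hq1 := h.q1
  have hm := h.mubar_pos
  have hD1 := h.D1
  have hη := h.ηle
  have hε0 := h.hε0
  set x := (DD n k p : ℝ) / mubar n k p with hx
  have hx0 : 0 < x := by positivity
  have h1 : interProb n k ^ (alphaP n k p σ - L) ≤ x ^ 2 * (n : ℝ) ^ (L * η) := by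
    have h2 : interProb n k ^ (alphaP n k p σ - L) * interProb n k ^ L ≤ x ^ 2 := by
      rw [← pow_add]
      refine le_trans (pow_le_pow_of_le_one hq0.le hq1.le ?_) h.q_alpha
      have : alpha2 n k p σ ≤ alphaP n k p σ := le_max_right _ _
      omega
    rw [← le_div_iff₀ (by positivity), div_eq_mul_inv] at h2
    exact h2.trans (mul_le_mul_of_nonneg_left (h.qinv_pow L) (by positivity))
  have hmx : mubar n k p * x = DD n k p := by rw [hx]; field_simp
  have hLη := h.L_eta
  have hη0 := h.η0
  calc ((DD n k p : ℝ) + 1) * (3 * mubar n k p * interProb n k ^ (alphaP n k p σ - L))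
      ≤ ((DD n k p : ℝ) + 1) * (3 * mubar n k p * (x ^ 2 * (n : ℝ) ^ (L * η))) := by gcongr
    _ = 3 * ((DD n k p : ℝ) + 1) * (mubar n k p * x) * (x * (n : ℝ) ^ (L * η)) := by ring
    _ ≤ (n : ℝ) ^ (1 / 2 - 2 * ε + 7 * η) * ((n : ℝ) ^ (-(1 / 2) + 3 * η) * (n : ℝ) ^ (L * η)) := by
        rw [hmx]
        have h5 := h.three_DD
        have h6 := h.D_div
        have := h.r_pos (L * η)
        have := h.r_pos (1 / 2 - 2 * ε + 7 * η)
        gcongr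
    _ ≤ _ := by
        rw [h.r_mul, h.r_mul]
        apply h.r_mono
        rw [← hL] at hLη
        linarith

lemma l_le (h : Good ε η n k p σ υ) : (⌈8 * Real.log n⌉₊ : ℝ) ≤ (n : ℝ) ^ η := by
  have := Nat.ceil_lt_add_one (by linarith [h.hlog4] : 0 ≤ 8 * Real.log n)
  linarith [h.hlog]

lemma small (h : Good ε η n k p σ υ) :
    (DD n k p : ℝ) ^ 2 * ⌈8 * Real.log n⌉₊ * ((k : ℝ) / n * (interProb n k ^ 9)⁻¹) ≤ 1 := by
  have h1 := h.D_le2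
  have h2 := h.l_le
  have h3 := h.k_div
  have h4 := h.qinv_pow 9
  have h5 := h.kpos
  have h6 := h.npos
  have h7 := h.q0
  calc (DD n k p : ℝ) ^ 2 * ⌈8 * Real.log n⌉₊ * ((k : ℝ) / n * (interProb n k ^ 9)⁻¹)
      ≤ ((n : ℝ) ^ (1 / 4 - ε + 3 * η)) ^ 2 * (n : ℝ) ^ η *
        ((n : ℝ) ^ (-(1 / 2) + η) * (n : ℝ) ^ ((9 : ℕ) * η)) := by
        gcongr
        linarith
    _ ≤ (n : ℝ) ^ (0 : ℝ) := by
        rw [h.r_pow, h.r_mul, h.r_mul, h.r_mul]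
        apply h.r_mono
        push_cast
        linarith [h.ηle, h.η0]
    _ = 1 := Real.rpow_zero _

lemma mubar_mul (h : Good ε η n k p σ υ) : mubar n k p * ((k : ℝ) / n) = phi n k p := by
  rw [phi_eq_mubar (by linarith [h.hk2]) (by linarith [h.hkn])]; ring

lemma err1 (h : Good ε η n k p σ υ) :
    (n.choose 1 : ℝ) * ((mubar n k p * ((k : ℝ) / n) ^ 1) ^ (DD n k p + 1) /
      ((DD n k p + 1).factorial : ℝ)) ≤ (n : ℝ) ^ (-(ε / 2)) := by
  rw [pow_one, h.mubar_mul, Nat.choose_one_right]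
  refine (mul_le_mul_of_nonneg_left h.tail h.npos.le).trans ?_
  nth_rewrite 1 [← h.r_one]
  rw [h.r_mul]
  exact h.r_mono (by linarith [h.hε1])

lemma err2 (h : Good ε η n k p σ υ) :
    (n.choose 2 : ℝ) * ((mubar n k p * ((k : ℝ) / n) ^ 2) ^ (9 + 1) /
      ((9 + 1).factorial : ℝ)) ≤ (n : ℝ) ^ (-(ε / 2)) := by
  have h1 : mubar n k p * ((k : ℝ) / n) ^ 2 ≤ (n : ℝ) ^ (-(1 / 4) : ℝ) := by
    rw [pow_two, ← mul_assoc, h.mubar_mul]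
    refine (mul_le_mul h.phi_le h.k_div (by positivity) (h.r_pos _).le).trans ?_
    rw [h.r_mul]
    exact h.r_mono (by linarith [h.ηle, h.hε0])
  have h0 : 0 ≤ mubar n k p * ((k : ℝ) / n) ^ 2 := by have := h.mubar_pos; positivity
  have h2 : (n.choose 2 : ℝ) ≤ (n : ℝ) ^ 2 := by exact_mod_cast Nat.choose_le_pow n 2
  have h3 : (1 : ℝ) ≤ ((9 + 1).factorial : ℝ) := by exact_mod_cast Nat.factorial_pos _
  calc _ ≤ (n : ℝ) ^ 2 * ((n : ℝ) ^ (-(1 / 4) : ℝ)) ^ (9 + 1) := by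
        refine mul_le_mul h2 ?_ (by positivity) (by positivity)
        exact (div_le_self (by positivity) h3).trans (pow_le_pow_left₀ h0 h1 _)
    _ ≤ _ := by
        rw [h.r_pow, ← Real.rpow_natCast (n : ℝ) 2, h.r_mul]
        apply h.r_mono
        push_cast
        linarith [h.hε1]

lemma err3 (h : Good ε η n k p σ υ) (l : ℕ) (hl : l = ⌈8 * Real.log n⌉₊) :
    (n.choose (l + 1) : ℝ) * ((mubar n k p * ((k : ℝ) / n) ^ (l + 1)) ^ 2 /
      ((2 : ℕ).factorial : ℝ)) ≤ (n : ℝ) ^ (-(ε / 2)) := by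
  have hn := h.npos
  have hm := h.mubar_pos
  have hll : 8 * Real.log n ≤ l := by rw [hl]; exact Nat.le_ceil _
  have h1 : (n.choose (l + 1) : ℝ) ≤ (n : ℝ) ^ (l + 1) / ((l + 1).factorial : ℝ) :=
    Nat.choose_le_pow_div (l + 1) n
  have h2 : ((k : ℝ) ^ 2 / n) ^ (l + 1) / ((l + 1).factorial : ℝ) ≤ (n : ℝ) ^ (-8 : ℝ) := by
    refine (pow_div_fact_le (by positivity) ?_).trans ?_
    · push_cast; linarith [h.hz, h.hlog4]
    · rw [← h.r_exp]
      apply Real.exp_le_exp.2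
      push_cast; linarith
  calc _ ≤ (n : ℝ) ^ (l + 1) / ((l + 1).factorial : ℝ) *
        (mubar n k p * ((k : ℝ) / n) ^ (l + 1)) ^ 2 := by
        refine mul_le_mul h1 (div_le_self (by positivity) ?_) (by positivity) (by positivity)
        norm_num
    _ = mubar n k p ^ 2 * (((k : ℝ) ^ 2 / n) ^ (l + 1) / ((l + 1).factorial : ℝ)) := by
        have : ((k : ℝ) ^ 2 / n) ^ (l + 1) = (n : ℝ) ^ (l + 1) * (((k : ℝ) / n) ^ (l + 1)) ^ 2 := by
          rw [← pow_mul, mul_comm (l + 1) 2, pow_mul, ← mul_pow]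
          congr 1
          field_simp
        rw [this]; ring
    _ ≤ (n : ℝ) ^ 2 * (n : ℝ) ^ (-8 : ℝ) := by
        have := h.mubar_le
        gcongr
    _ ≤ _ := by
        rw [← Real.rpow_natCast (n : ℝ) 2, h.r_mul]
        apply h.r_mono
        push_cast
        linarith [h.hε1]

lemma err4 (h : Good ε η n k p σ υ) :
    (n : ℝ) * (2 * ((n : ℝ) ^ (-(3 / 4 * ε))) ^ ⌈2 / ε⌉₊) ≤ 2 * (n : ℝ) ^ (-(ε / 2)) := by
  rw [h.r_pow]
  have h2 : 2 / ε * ε = 2 := div_mul_cancel₀ _ h.hε0.ne'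
  have h3 := mul_le_mul_of_nonneg_right h.L_bound.1 h.hε0.le
  have : (n : ℝ) * (2 * (n : ℝ) ^ (-(3 / 4 * ε) * (⌈2 / ε⌉₊ : ℝ)))
      = 2 * (n : ℝ) ^ (1 + -(3 / 4 * ε) * (⌈2 / ε⌉₊ : ℝ)) := by
    rw [← h.r_mul, h.r_one]; ring
  rw [this]
  apply mul_le_mul_of_nonneg_left _ (by norm_num)
  apply h.r_mono
  linarith [h.hε1]

lemma M_ge (h : Good ε η n k p σ υ) : 2 * (DD n k p : ℝ) ≤ ((n - 1).choose (k - 1) : ℝ) := by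
  have hk2 := h.hk2
  have hkn := h.hkn
  have h1 : n - 1 ≤ (n - 1).choose (k - 1) := le_choose_self (by omega) (by omega)
  have h2 : (n : ℝ) - 1 ≤ ((n - 1).choose (k - 1) : ℝ) := by
    have : ((n - 1 : ℕ) : ℝ) = n - 1 := by rw [Nat.cast_sub (by omega)]; simp
    rw [← this]; exact_mod_cast h1
  refine le_trans ?_ h2
  have := h.three_DD
  have h4 : (n : ℝ) ^ (1 / 2 - 2 * ε + 7 * η) ≤ (n : ℝ) ^ (1 : ℝ) :=
    h.r_mono (by linarith [h.ηle, h.hε0, h.eta_small])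
  rw [h.r_one] at h4
  nlinarith [h.D1]

lemma err5 (h : Good ε η n k p σ υ) :
    (n : ℝ) * (binomProbGe ((n - 1).choose (k - 1)) p (alphaP n k p σ - ⌈2 / ε⌉₊) *
      (⌈2 / ε⌉₊ * (n : ℝ) ^ (-ε))) ≤ (n : ℝ) ^ (-(ε / 2)) := by
  have hk2 := h.hk2
  have hkn := h.hkn
  set L := ⌈2 / ε⌉₊ with hL
  set a := alphaP n k p σ with ha
  set M := (n - 1).choose (k - 1) with hM
  have haD : (a : ℝ) ≤ DD n k p := by exact_mod_cast h.alphaP_le_D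
  have hMg : 2 * (DD n k p : ℝ) ≤ (M : ℝ) := h.M_ge
  have haM : a < M := by
    have : (a : ℝ) < M := by linarith [h.D1]
    exact_mod_cast this
  set r := 2 * (n : ℝ) ^ (2 * η) with hr
  have hr0 : 0 ≤ r := by have := h.r_pos (2 * η); positivity
  have hphi : phi n k p = p * M := rfl
  have hcond : (a : ℝ) + 1 ≤ r * (((M : ℝ) - a) * p) := by
    have h1 := h.D_le1
    rw [hphi] at h1
    have h2 : (M : ℝ) / 2 * p ≤ ((M : ℝ) - a) * p :=
      mul_le_mul_of_nonneg_right (by linarith) h.hp0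
    calc (a : ℝ) + 1 ≤ p * M * (n : ℝ) ^ (2 * η) := by linarith
      _ = r * ((M : ℝ) / 2 * p) := by rw [hr]; ring
      _ ≤ _ := mul_le_mul_of_nonneg_left h2 hr0
  have hit := binomProbGe_iter h.hp0 h.hp1 hr0 haM hcond (L + 1)
  have h1 : binomProbGe M p (a + 1) ≤ Real.log n / n :=
    binomProbGe_alpha1 (by omega) (le_max_left _ _ : alpha1 n k p ≤ alphaP n k p σ)
  rw [Nat.add_sub_add_right] at hit
  have hr3 : 1 + r ≤ (n : ℝ) ^ (3 * η) := by
    have h3 : (n : ℝ) ^ (3 * η) = (n : ℝ) ^ (2 * η) * (n : ℝ) ^ η := by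
      rw [h.r_mul]; congr 1; ring
    have h4 : (1 : ℝ) ≤ (n : ℝ) ^ (2 * η) := Real.one_le_rpow h.n1 (by linarith [h.η0])
    have h5 : (3 : ℝ) ≤ (n : ℝ) ^ η := by linarith [h.hlog, h.hlog4]
    rw [h3, hr]
    nlinarith
  have hlogη : Real.log n ≤ (n : ℝ) ^ η := by linarith [h.hlog, h.hlog4]
  have hLη : (L : ℝ) ≤ (n : ℝ) ^ η := h.L_bound.2.le.trans h.hεn
  have hlog0 : 0 ≤ Real.log n := by linarith [h.hlog4]
  have hb : binomProbGe M p (a - L) ≤ (n : ℝ) ^ (3 * η * ((L + 1 : ℕ) : ℝ)) * ((n : ℝ) ^ η / n) := by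
    refine hit.trans ?_
    rw [← h.r_pow]
    refine mul_le_mul (pow_le_pow_left₀ (by linarith) hr3 _) (h1.trans ?_)
      (binomProbGe_nonneg h.hp0 h.hp1 _) (pow_pos (h.r_pos _) _).le
    exact div_le_div_of_nonneg_right hlogη h.npos.le
  have hn := h.npos
  calc (n : ℝ) * (binomProbGe M p (a - L) * (L * (n : ℝ) ^ (-ε)))
      ≤ (n : ℝ) * ((n : ℝ) ^ (3 * η * ((L + 1 : ℕ) : ℝ)) * ((n : ℝ) ^ η / n) *
        ((n : ℝ) ^ η * (n : ℝ) ^ (-ε))) := by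
        have := h.r_pos (-ε)
        have := h.r_pos (3 * η * ((L + 1 : ℕ) : ℝ))
        have := h.r_pos η
        gcongr
    _ = (n : ℝ) ^ (3 * η * ((L + 1 : ℕ) : ℝ)) * (n : ℝ) ^ η * ((n : ℝ) ^ η * (n : ℝ) ^ (-ε)) := by
        field_simp
    _ ≤ _ := by
        rw [h.r_mul, h.r_mul, h.r_mul]
        apply h.r_mono
        have := h.L_eta
        rw [← hL] at this
        push_cast
        linarith [h.ηle, h.hε0]

lemma final (h : Good ε η n k p σ υ) :
    PP p (kSets n k) (fun H => ∃ C ⊆ H, ∃ x : Fin n, IsClique C ∧ IsNontrivial C ∧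
        vdeg H x ≤ C.card ∧ tauP ε n k p σ ≤ (vdeg C x : ℝ) ∧
        (alphaP n k p σ ≤ C.card ∨ 2 / ε ≤ ((C \ starOf C x).card : ℝ)))
      ≤ 6 * (n : ℝ) ^ (-(ε / 2)) := by
  have hk2 := h.hk2
  have hkn := h.hkn
  have hb := main_bound (n := n) (k := k) (by omega) (by omega) h.hp0 h.hp1 (DD n k p) 9
    ⌈8 * Real.log n⌉₊ ⌈2 / ε⌉₊ (alphaP n k p σ) (tauP ε n k p σ) (2 / ε) h.L_bound.1 h.L_bound.2
    h.q0 h.q1.le h.small ((n : ℝ) ^ (-(3 / 4 * ε))) ((n : ℝ) ^ (-ε)) h.rho1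
    ((h.nsmall (by linarith [h.ηle, h.η0])).trans (by norm_num)) h.rho2
    ((h.nsmall (by linarith [h.ηle, h.η0])).trans (by norm_num))
  have e1 := h.err1
  have e2 := h.err2
  have e3 := h.err3 _ rfl
  have e4 := h.err4
  have e5 := h.err5
  linarith

end Good

lemma ev_const {θ : ℝ} (hθ : 0 < θ) (C : ℝ) : ∀ᶠ n : ℕ in atTop, C ≤ (n : ℝ) ^ θ :=
  ((tendsto_rpow_atTop hθ).comp tendsto_natCast_atTop_atTop).eventually_ge_atTop C

lemma ev_logc (C : ℝ) : ∀ᶠ n : ℕ in atTop, C ≤ Real.log n :=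
  (Real.tendsto_log_atTop.comp tendsto_natCast_atTop_atTop).eventually_ge_atTop C

lemma ev_log {θ : ℝ} (hθ : 0 < θ) : ∀ᶠ n : ℕ in atTop, Real.log n ≤ (n : ℝ) ^ θ := by
  have h := (isLittleO_log_rpow_atTop hθ).bound (by norm_num : (0 : ℝ) < 1)
  have h2 := tendsto_natCast_atTop_atTop.eventually h
  filter_upwards [h2] with n hn
  rw [one_mul, Real.norm_eq_abs, Real.norm_eq_abs,
    abs_of_nonneg (Real.rpow_nonneg (Nat.cast_nonneg _) _)] at hn
  exact (le_abs_self _).trans hn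

lemma rp_add {n : ℕ} (hn : 1 ≤ n) (a b : ℝ) : (n : ℝ) ^ a * (n : ℝ) ^ b = (n : ℝ) ^ (a + b) :=
  (Real.rpow_add (by exact_mod_cast hn) a b).symm

lemma ev_kup {ε : ℝ} (hε0 : 0 < ε) (hε14 : ε < 1 / 4) {k : ℕ → ℕ}
    (hkup : ∀ᶠ n in atTop, (k n : ℝ) < Real.sqrt ((1 / 4 - ε) * n * Real.log n)) :
    ∀ᶠ n : ℕ in atTop, (k n : ℝ) ^ 2 ≤ (1 / 4 - ε) * n * Real.log n := by
  filter_upwards [hkup, ev_logc 0] with n h1 h2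
  have h3 : 0 ≤ (1 / 4 - ε) * n * Real.log n := by
    have : 0 ≤ 1 / 4 - ε := by linarith
    positivity
  calc (k n : ℝ) ^ 2 ≤ Real.sqrt ((1 / 4 - ε) * n * Real.log n) ^ 2 :=
        pow_le_pow_left₀ (Nat.cast_nonneg _) h1.le 2
    _ = _ := Real.sq_sqrt h3

lemma ev_kup' {ε : ℝ} (hε0 : 0 < ε) (hε14 : ε < 1 / 4) {k : ℕ → ℕ}
    (hkup : ∀ᶠ n in atTop, (k n : ℝ) < Real.sqrt ((1 / 4 - ε) * n * Real.log n))
    {η : ℝ} (hη : 0 < η) : ∀ᶠ n : ℕ in atTop, (k n : ℝ) ≤ (n : ℝ) ^ (1 / 2 + η) := by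
  filter_upwards [ev_kup hε0 hε14 hkup, ev_log (by positivity : 0 < 2 * η), ev_logc 0,
    eventually_ge_atTop 1] with n h1 h2 h3 h4
  refine (sq_le_sq₀ (Nat.cast_nonneg _) (Real.rpow_nonneg (Nat.cast_nonneg _) _)).1 ?_
  refine h1.trans ?_
  have h5 : ((n : ℝ) ^ (1 / 2 + η)) ^ 2 = n * (n : ℝ) ^ (2 * η) := by
    rw [pow_two, rp_add h4]
    nth_rewrite 2 [← Real.rpow_one (n : ℝ)]
    rw [rp_add h4]
    congr 1; ring
  rw [h5]
  have h6 : (n : ℝ) * Real.log n ≤ n * (n : ℝ) ^ (2 * η) :=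
    mul_le_mul_of_nonneg_left h2 (Nat.cast_nonneg _)
  have h7 : 0 ≤ (n : ℝ) * Real.log n := by positivity
  nlinarith

lemma ev_klow {k : ℕ → ℕ} {δ : ℕ → ℝ} (hδ : Tendsto δ atTop (nhds 0))
    (hklow : ∀ᶠ n : ℕ in atTop, (n : ℝ) ^ ((1 : ℝ) / 2 - δ n) < (k n : ℝ))
    {η : ℝ} (hη : 0 < η) : ∀ᶠ n : ℕ in atTop, (n : ℝ) ^ (1 / 2 - η) ≤ (k n : ℝ) := by
  filter_upwards [hδ.eventually (eventually_le_nhds hη), hklow, eventually_ge_atTop 1]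
    with n h1 h2 h3
  refine le_trans ?_ h2.le
  exact Real.rpow_le_rpow_of_exponent_le (by exact_mod_cast h3) (by linarith)

lemma ev_q {k : ℕ → ℕ} {δ : ℕ → ℝ} (hδ : Tendsto δ atTop (nhds 0))
    (hnk : ∀ᶠ n in atTop, 2 * k n < n)
    (hklow : ∀ᶠ n : ℕ in atTop, (n : ℝ) ^ ((1 : ℝ) / 2 - δ n) < (k n : ℝ))
    {η : ℝ} (hη : 0 < η) : ∀ᶠ n : ℕ in atTop, (n : ℝ) ^ (-η) ≤ interProb n (k n) := by
  filter_upwards [ev_klow hδ hklow (by positivity : 0 < η / 4), hnk, eventually_ge_atTop 1,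
    ev_const (by positivity : 0 < η / 2) 4] with n h1 h2 h3 h4
  have hn : (0 : ℝ) < n := by exact_mod_cast h3
  have hz := interProb_ge' h2 (z := (k n : ℝ) ^ 2 / n) rfl
  set z := (k n : ℝ) ^ 2 / n with hzd
  have hz0 : (n : ℝ) ^ (-(η / 2)) ≤ z := by
    rw [hzd, le_div_iff₀ hn]
    have h5 : (n : ℝ) ^ (-(η / 2)) * n = ((n : ℝ) ^ (1 / 2 - η / 4)) ^ 2 := by
      rw [pow_two, rp_add h3]
      nth_rewrite 2 [← Real.rpow_one (n : ℝ)]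
      rw [rp_add h3]
      congr 1; ring
    rw [h5]
    exact pow_le_pow_left₀ (Real.rpow_nonneg hn.le _) h1 2
  by_contra hcon
  push Not at hcon
  have h6 : (n : ℝ) ^ (-(η / 2)) * (n : ℝ) ^ (η / 2) = 1 := by rw [rp_add h3]; simp
  have h7 : (n : ℝ) ^ (-η) = (n : ℝ) ^ (-(η / 2)) * (n : ℝ) ^ (-(η / 2)) := by
    rw [rp_add h3]; congr 1; ring
  have h8 : 0 < (n : ℝ) ^ (-(η / 2)) := Real.rpow_pos_of_pos hn _
  set w := (n : ℝ) ^ (-(η / 2)) with hw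
  have h9 : w ≤ 1 / 4 := by nlinarith
  rw [h7] at hcon
  have h10 : interProb n (k n) < w / 4 := by nlinarith
  nlinarith

lemma ev_q' {ε : ℝ} (hε0 : 0 < ε) (hε14 : ε < 1 / 4) {k : ℕ → ℕ}
    (hnk : ∀ᶠ n in atTop, 2 * k n < n)
    (hkup : ∀ᶠ n in atTop, (k n : ℝ) < Real.sqrt ((1 / 4 - ε) * n * Real.log n))
    {η : ℝ} (hη : 0 < η) (hη1 : η ≤ 1 / 4) :
    ∀ᶠ n : ℕ in atTop, (n : ℝ) ^ (-(1 / 4 - ε + η)) ≤ 1 - interProb n (k n) := by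
  filter_upwards [ev_kup hε0 hε14 hkup, ev_kup' hε0 hε14 hkup (by norm_num : (0 : ℝ) < 1 / 4),
    hnk, eventually_ge_atTop 1, ev_const (by norm_num : (0 : ℝ) < 1 / 4) (1 / η), ev_logc 0]
    with n h1 h2 h3 h4 h5 h6
  have hn : (0 : ℝ) < n := by exact_mod_cast h4
  refine le_trans ?_ (interProb_le h3)
  rw [Real.rpow_def_of_pos hn]
  apply Real.exp_le_exp.2
  have h7 : (0 : ℝ) < n - 2 * k n := by
    have : (2 : ℝ) * k n < n := by exact_mod_cast h3
    linarith
  have h8 : (k n : ℝ) ≤ η * n := by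
    have h9 : (n : ℝ) = (n : ℝ) ^ (1 / 2 + 1 / 4 : ℝ) * (n : ℝ) ^ (1 / 4 : ℝ) := by
      rw [rp_add h4]
      nth_rewrite 1 [← Real.rpow_one (n : ℝ)]
      congr 1; norm_num
    have h10 : 1 ≤ η * (n : ℝ) ^ (1 / 4 : ℝ) := by
      rw [div_le_iff₀ hη] at h5; linarith
    have h11 := Real.rpow_nonneg hn.le (1 / 2 + 1 / 4 : ℝ)
    calc (k n : ℝ) ≤ (n : ℝ) ^ (1 / 2 + 1 / 4 : ℝ) := h2
      _ ≤ (n : ℝ) ^ (1 / 2 + 1 / 4 : ℝ) * (η * (n : ℝ) ^ (1 / 4 : ℝ)) :=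
        le_mul_of_one_le_right h11 h10
      _ = η * ((n : ℝ) ^ (1 / 2 + 1 / 4 : ℝ) * (n : ℝ) ^ (1 / 4 : ℝ)) := by ring
      _ = η * n := by rw [← h9]
  have h9 : (k n : ℝ) ^ 2 / (n - 2 * k n) ≤ (1 / 4 - ε + η) * Real.log n := by
    rw [div_le_iff₀ h7]
    refine h1.trans ?_
    have h10 : (1 / 4 - ε) * n ≤ (1 / 4 - ε + η) * (n - 2 * k n) := by
      have : (0 : ℝ) ≤ k n := Nat.cast_nonneg _
      nlinarith
    calc (1 / 4 - ε) * n * Real.log n ≤ (1 / 4 - ε + η) * (n - 2 * k n) * Real.log n :=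
          mul_le_mul_of_nonneg_right h10 h6
      _ = _ := by ring
  linarith

set_option maxHeartbeats 800000 in
lemma ev_good (ε : ℝ) (hε0 : 0 < ε) (hε14 : ε < 1 / 4)
    (k : ℕ → ℕ) (p : ℕ → ℝ)
    (hp0 : ∀ n, 0 ≤ p n) (hp1 : ∀ n, p n ≤ 1)
    (hnk : ∀ᶠ n in atTop, 2 * k n < n)
    (δ : ℕ → ℝ) (hδ : Tendsto δ atTop (nhds 0))
    (hklow : ∀ᶠ n : ℕ in atTop, (n : ℝ) ^ ((1 : ℝ) / 2 - δ n) < (k n : ℝ))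
    (hkup : ∀ᶠ n in atTop, (k n : ℝ) < Real.sqrt ((1 / 4 - ε) * n * Real.log n))
    (σ υ : ℕ → ℝ) (hσ : Tendsto σ atTop (nhds 0)) (hυ : Tendsto υ atTop (nhds 0))
    (hLam : ∀ᶠ n in atTop,
      hprob n (k n) (p n) (fun H => σ n < Lam n (k n) (p n) (maxDegree H)) < υ n)
    (hφ : ∀ᶠ n in atTop, phi n (k n) (p n) ≤ phiStar n (k n)) :
    ∀ᶠ n in atTop, Good ε (ε ^ 2 / 100) n (k n) (p n) (σ n) (υ n) := by
  set η := ε ^ 2 / 100 with hη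
  have hη0 : 0 < η := by positivity
  have hη1 : η ≤ 1 / 1600 := by rw [hη]; nlinarith
  set s0 := ⌈2 / η⌉₊ with hs0
  have hs0' : 2 / η ≤ s0 := Nat.le_ceil _
  have hs0p : (0 : ℝ) < s0 := lt_of_lt_of_le (by positivity) hs0'
  have hθ : 0 < 1 / (12 * (s0 : ℝ)) := by positivity
  filter_upwards [hnk, ev_q hδ hnk hklow hη0, ev_q' hε0 hε14 hnk hkup hη0 (by linarith),
    ev_klow hδ hklow hη0, ev_klow hδ hklow (by norm_num : (0 : ℝ) < 1 / 4),
    ev_kup' hε0 hε14 hkup hη0, ev_kup hε0 hε14 hkup, hφ,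
    ev_log (by positivity : 0 < η / 3), ev_const (by positivity : 0 < η / 2) 18, ev_logc 4,
    ev_const hη0 (2 / ε + 1), hLam, hσ.eventually (eventually_le_nhds (by norm_num : (0 : ℝ) < 1 / 16)),
    hυ.eventually (eventually_le_nhds (Real.exp_pos (-20))), eventually_ge_atTop 20,
    ev_q hδ hnk hklow hθ, ev_const (by norm_num : (0 : ℝ) < 1 / 4) (2 + 2 * (s0 : ℝ) ^ 3),
    ev_kup' hε0 hε14 hkup (by norm_num : (0 : ℝ) < 1 / 24), ev_log (by positivity : 0 < η / 2)]
    with n a1 a2 a3 a4 a5 a6 a7 a8 a9 a10 a11 a12 a13 a14 a15 a16 a17 a18 a19 a20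
  have hn1 : 1 ≤ n := by omega
  have hn : (0 : ℝ) < n := by exact_mod_cast hn1
  have hn1' : (1 : ℝ) ≤ n := by exact_mod_cast hn1
  have hk2 : 2 ≤ k n := by
    have : (2 : ℝ) ≤ k n := by
      have h1 : (1 / 2 - 1 / 4 : ℝ) = 1 / 4 := by norm_num
      rw [h1] at a5
      have : 0 ≤ (s0 : ℝ) ^ 3 := by positivity
      linarith
    exact_mod_cast this
  have hq0 : 0 < interProb n (k n) := lt_of_lt_of_le (Real.rpow_pos_of_pos hn _) a2
  have hq1 : interProb n (k n) ≤ 1 := by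
    have := Real.rpow_pos_of_pos hn (-(1 / 4 - ε + η)); linarith
  have hυ2 : υ n ≤ 1 / 2 := by
    refine a15.trans ?_
    have h5 : Real.exp (-20) * Real.exp 20 = 1 := by rw [← Real.exp_add]; simp
    have h6 := Real.add_one_le_exp (20 : ℝ)
    nlinarith [Real.exp_pos (-20)]
  have hφ0 : (n : ℝ) ^ (-η) ≤ phi n (k n) (p n) := by
    refine phi_lower (s0 := s0) (B := s0 * (n : ℝ) ^ (1 / 24 : ℝ)) (by omega) a1 a16 (hp0 n) (hp1 n)
      a13 a14 a15 hq0 hq1 (by exact_mod_cast hs0p) ?_ (by positivity) ?_ ?_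
    · rw [← Real.rpow_natCast, ← Real.rpow_mul hn.le]
      nth_rewrite 1 [← Real.rpow_one (n : ℝ)]
      rw [rp_add hn1]
      have h1 : 2 ≤ s0 * η := by rwa [div_le_iff₀ hη0] at hs0'
      have h2 : (n : ℝ) ^ (1 + -η * s0) ≤ (n : ℝ) ^ (-1 : ℝ) :=
        Real.rpow_le_rpow_of_exponent_le hn1' (by linarith)
      refine h2.trans ?_
      rw [Real.rpow_neg_one, ← one_div]
      apply one_div_le_one_div_of_le (by norm_num)
      have : (20 : ℝ) ≤ n := by exact_mod_cast a16
      linarith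
    · rw [mul_pow]
      apply mul_le_mul_of_nonneg_left _ (by positivity)
      have h1 : ((n : ℝ) ^ (-(1 / (12 * (s0 : ℝ))))) ^ s0 ≤ interProb n (k n) ^ s0 :=
        pow_le_pow_left₀ (Real.rpow_nonneg hn.le _) a17 _
      have h2 : ((n : ℝ) ^ (-(1 / (12 * (s0 : ℝ))))) ^ s0 = (((n : ℝ) ^ (1 / 24 : ℝ)) ^ 2)⁻¹ := by
        rw [← Real.rpow_natCast, ← Real.rpow_mul hn.le, ← Real.rpow_natCast, ← Real.rpow_mul hn.le,
          ← Real.rpow_neg hn.le]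
        congr 1; field_simp; norm_num
      rw [h2] at h1
      exact inv_le_of_inv_le₀ (by positivity) h1
    · have h1 : (s0 : ℝ) * (n : ℝ) ^ (1 / 24 : ℝ) * k n / n
          ≤ s0 * (n : ℝ) ^ (-(5 / 12) : ℝ) := by
        rw [div_le_iff₀ hn]
        have h2 : (n : ℝ) ^ (-(5 / 12) : ℝ) * n
            = (n : ℝ) ^ (1 / 24 : ℝ) * (n : ℝ) ^ (1 / 2 + 1 / 24 : ℝ) := by
          nth_rewrite 2 [← Real.rpow_one (n : ℝ)]
          rw [rp_add hn1, rp_add hn1]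
          congr 1; norm_num
        rw [mul_assoc, mul_assoc, h2]
        gcongr
      have h3 := pow_le_pow_left₀ (by positivity) h1 3
      have h4 : (n : ℝ) * (s0 * (n : ℝ) ^ (-(5 / 12) : ℝ)) ^ 3
          = (s0 : ℝ) ^ 3 * (n : ℝ) ^ (-(1 / 4) : ℝ) := by
        rw [mul_pow, ← Real.rpow_natCast ((n : ℝ) ^ (-(5 / 12) : ℝ)), ← Real.rpow_mul hn.le]
        have : (n : ℝ) ^ (-(1 / 4) : ℝ) = n * (n : ℝ) ^ (-(5 / 12) * ((3 : ℕ) : ℝ)) := by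
          nth_rewrite 2 [← Real.rpow_one (n : ℝ)]
          rw [rp_add hn1]
          congr 1; norm_num
        rw [this]; ring
      have h5 : (n : ℝ) ^ (-(1 / 4) : ℝ) * (n : ℝ) ^ (1 / 4 : ℝ) = 1 := by
        rw [rp_add hn1]; norm_num
      have h6 : 0 < (n : ℝ) ^ (-(1 / 4) : ℝ) := Real.rpow_pos_of_pos hn _
      refine (mul_le_mul_of_nonneg_left h3 hn.le).trans ?_
      rw [h4]
      have h7 := mul_le_mul_of_nonneg_left a18 h6.le
      rw [h5] at h7
      linarith
  refine ⟨hε0, hε14, rfl, hp0 n, hp1 n, hk2, a1, a2, a3, a4, a6, ?_, hφ0, a8, ?_, ?_, a11, a12, a13,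
    by linarith, hυ2⟩
  · rw [div_le_iff₀ hn]
    have : 0 ≤ ε * (n * Real.log n) := by positivity
    linarith
  · have h1 : (n : ℝ) ^ η = (n : ℝ) ^ (η / 2) * (n : ℝ) ^ (η / 2) := by
      rw [rp_add hn1]; congr 1; ring
    rw [h1]
    have h2 := mul_le_mul_of_nonneg_right a10 (by linarith : 0 ≤ (n : ℝ) ^ (η / 2))
    linarith
  · have h1 : (n : ℝ) ^ η = ((n : ℝ) ^ (η / 3)) ^ 3 := by
      rw [← Real.rpow_natCast, ← Real.rpow_mul hn.le]
      congr 1; push_cast; ring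
    rw [h1]
    exact pow_le_pow_left₀ (by linarith) a9 3

/-- **Lemma A.** Under the standing assumptions (`0 < ε < 1/4`, `n^{1/2-o(1)} < k <
√((1/4-ε) n log n)`, `Λ(Δ) < o(1)` a.s., `φ ≤ φ*`), almost surely there do not exist in
`H = H_k(n,p)` a nontrivial clique `C` and a vertex `x` with `|C| ≥ d_H(x)`,
`d_C(x) ≥ τ`, and either `|C| ≥ α` or `|C ∖ C_x| ≥ 2/ε`. -/
theorem no_high_degree_nontrivial_clique
    (ε : ℝ) (hε0 : 0 < ε) (hε14 : ε < 1 / 4)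
    (k : ℕ → ℕ) (p : ℕ → ℝ)
    (hp0 : ∀ n, 0 ≤ p n) (hp1 : ∀ n, p n ≤ 1)
    (hnk : ∀ᶠ n in atTop, 2 * k n < n)
    (δ : ℕ → ℝ) (hδ : Tendsto δ atTop (nhds 0))
    (hklow : ∀ᶠ n : ℕ in atTop, (n : ℝ) ^ ((1 : ℝ) / 2 - δ n) < (k n : ℝ))
    (hkup : ∀ᶠ n in atTop, (k n : ℝ) < Real.sqrt ((1 / 4 - ε) * n * Real.log n))
    (σ υ : ℕ → ℝ) (hσ : Tendsto σ atTop (nhds 0)) (hυ : Tendsto υ atTop (nhds 0))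
    (hLam : ∀ᶠ n in atTop,
      hprob n (k n) (p n) (fun H => σ n < Lam n (k n) (p n) (maxDegree H)) < υ n)
    (hφ : ∀ᶠ n in atTop, phi n (k n) (p n) ≤ phiStar n (k n))
    :
    Tendsto (fun n => hprob n (k n) (p n) (fun H =>
      ¬ ∃ C ⊆ H, ∃ x : Fin n, IsClique C ∧ IsNontrivial C ∧
        vdeg H x ≤ C.card ∧
        tauP ε n (k n) (p n) (σ n) ≤ (vdeg C x : ℝ) ∧
        (alphaP n (k n) (p n) (σ n) ≤ C.card ∨
          2 / ε ≤ ((C \ starOf C x).card : ℝ)))) atTop (nhds 1) := by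
  have hg := ev_good ε hε0 hε14 k p hp0 hp1 hnk δ hδ hklow hkup σ υ hσ hυ hLam hφ
  have hlim : Tendsto (fun n : ℕ => 1 - 6 * (n : ℝ) ^ (-(ε / 2))) atTop (nhds 1) := by
    have h1 := (tendsto_rpow_neg_atTop (half_pos hε0)).comp (tendsto_natCast_atTop_atTop (R := ℝ))
    have h2 := (h1.const_mul 6).const_sub 1
    simpa using h2
  refine tendsto_of_tendsto_of_tendsto_of_le_of_le' hlim tendsto_const_nhds ?_ ?_
  · filter_upwards [hg] with n h
    rw [hprob_eq_PP, PP_compl]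
    linarith [h.final]
  · filter_upwards with n
    rw [hprob_eq_PP, PP_compl]
    linarith [PP_nonneg (hp0 n) (hp1 n) (kSets n (k n)) (fun H =>
      ∃ C ⊆ H, ∃ x : Fin n, IsClique C ∧ IsNontrivial C ∧
        vdeg H x ≤ C.card ∧
        tauP ε n (k n) (p n) (σ n) ≤ (vdeg C x : ℝ) ∧
        (alphaP n (k n) (p n) (σ n) ≤ C.card ∨
          2 / ε ≤ ((C \ starOf C x).card : ℝ)))]
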